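/- arXiv:1912.08183 — 2 statements merged into one kernel-verified Lean document; each statement's English description precedes it below -/
import Mathlib

section
/- Let c := 1/(16π²), 0 < β ≤ 2 and 0 < δ̄ ≤ c/4, let δ : [0, μ_max] → ℝ be smooth with δ′ = β·δ² and 0 < δ(μ) ≤ δ̄, and let (h_n) be a smooth solution of the one-particle irreducible mean field hierarchy with h₂ = −δ. Then: (i) h₄(μ) = J₀(μ)^{−1}·(δ(μ) − β·δ(μ)²) > (1 − δ(μ))²·(δ(μ) − β·δ(μ)²)/c > 0 for all μ; (ii) for every K ≥ 4/c, setting 𝓑(n,l;μ) := δ(μ)²·K^{n+l−2}·(n+l−2)! / ((n+2)·(n+1)·(l+2)·(l+1)), one has |∂_μ^{l} h_n(μ)| ≤ 𝓑(n,l;μ) for all even n ≥ 6 and all l ≥ 0, as well as for n = 4 and all l ≥ 1, and |h₄(μ)| ≤ 𝓑(4,0;μ)·4c/δ(μ) for all μ ∈ [0, μ_max]. -/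
open MeasureTheory

/-- `c = 1/(16π²)`. -/
noncomputable def mfc : ℝ := 1 / (16 * Real.pi ^ 2)

/-- The cutoff propagator `C^{γ,1}(q) = ∫_γ^1 e^{−ζ|q|²} dζ`. -/
noncomputable def cutoffProp (γ : ℝ) (q : EuclideanSpace ℝ (Fin 4)) : ℝ :=
  ∫ ζ in γ..1, Real.exp (-(ζ * ‖q‖ ^ 2))

/-- The fluctuation integral `J_v(μ)` with `γ(μ) = e^{−μ}`. -/
noncomputable def Jflow (δ : ℝ → ℝ) (v : ℕ) (μ : ℝ) : ℝ :=
  (1 / (2 * Real.pi) ^ 4) *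
    ∫ q : EuclideanSpace ℝ (Fin 4),
      Real.exp (-‖q‖ ^ 2) * cutoffProp (Real.exp (-μ)) q ^ v *
        ((1 - δ μ * cutoffProp (Real.exp (-μ)) q) ^ (2 + v))⁻¹

/-- The one-particle irreducible mean field hierarchy with `h₂ = −δ`:
smooth functions `h n` (even `n ≥ 2`) satisfying, on `[0, μmax]`,
`J₀·h_{n+2} = Σ_{v=2}^{n/2} (−1)^v J_{v−1} Σ_{(b₁,…,b_v)} ∏_k h_{b_k+2}
  + (2/(n(n−1)))·h_n′ + ((n−4)/(n(n−1)))·h_n`,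
the inner sum running over ordered `v`-tuples of positive even integers summing to `n`. -/
def OnePIHierarchy (μmax : ℝ) (δ : ℝ → ℝ) (h : ℕ → ℝ → ℝ) : Prop :=
  (∀ n, ContDiff ℝ (⊤ : ℕ∞) (h n)) ∧
  (∀ μ : ℝ, h 2 μ = -δ μ) ∧
  (∀ n : ℕ, Even n → 2 ≤ n → ∀ μ ∈ Set.Icc (0 : ℝ) μmax,
    Jflow δ 0 μ * h (n + 2) μ =
      (∑ v ∈ Finset.Icc 2 (n / 2), (-1 : ℝ) ^ v * Jflow δ (v - 1) μ *
        ∑ b ∈ Finset.Nat.antidiagonalTuple v n,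
          if ∀ k, Even (b k) ∧ 0 < b k then ∏ k, h (b k + 2) μ else 0)
      + (2 / ((n : ℝ) * ((n : ℝ) - 1))) * deriv (h n) μ
      + (((n : ℝ) - 4) / ((n : ℝ) * ((n : ℝ) - 1))) * h n μ)

/-- Sums over `(v+1)`-tuples split off the first entry. -/
theorem sum_antidiagonalTuple_succ {M : Type*} [AddCommMonoid M] (v n : ℕ)
    (f : (Fin (v + 1) → ℕ) → M) :
    ∑ b ∈ Finset.Nat.antidiagonalTuple (v + 1) n, f b =
      ∑ p ∈ Finset.HasAntidiagonal.antidiagonal n, ∑ b ∈ Finset.Nat.antidiagonalTuple v p.2,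
        f (Fin.cons p.1 b) := by
  rw [Finset.sum_sigma']
  refine Finset.sum_bij' (fun b _ => ⟨(b 0, ∑ i, Fin.tail b i), Fin.tail b⟩)
    (fun x _ => Fin.cons x.1.1 x.2) ?_ ?_ ?_ ?_ ?_
  · intro b hb
    rw [Finset.Nat.mem_antidiagonalTuple, Fin.sum_univ_succ] at hb
    simp [Finset.Nat.mem_antidiagonalTuple, Fin.tail, hb]
  · rintro ⟨⟨i, j⟩, b⟩ hb
    simp only [Finset.mem_sigma, Finset.HasAntidiagonal.mem_antidiagonal,
      Finset.Nat.mem_antidiagonalTuple] at hb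
    simp [Finset.Nat.mem_antidiagonalTuple, Fin.sum_univ_succ, hb]
  · intro b _
    simp
  · rintro ⟨⟨i, j⟩, b⟩ hb
    simp only [Finset.mem_sigma, Finset.HasAntidiagonal.mem_antidiagonal,
      Finset.Nat.mem_antidiagonalTuple] at hb
    simp [hb]
  · intro b _
    simp

theorem factorial_mul_factorial_le {i j : ℕ} (hi : 0 < i) (hj : 0 < j) :
    i.factorial * j.factorial ≤ (i + j - 1).factorial := by
  induction j, hj using Nat.le_induction with
  | base => simp
  | succ j hj ih =>
    have e : i + (j + 1) - 1 = (i + j - 1) + 1 := by omega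
    rw [e, Nat.factorial_succ, Nat.factorial_succ]
    calc i.factorial * ((j + 1) * j.factorial)
        = (j + 1) * (i.factorial * j.factorial) := by ring
      _ ≤ (i + j - 1 + 1) * (i + j - 1).factorial := Nat.mul_le_mul (by omega) ih

/-- The factorial on positive integers, extended by `0` at `0`. -/
def posFactorial (n : ℕ) : ℕ := if 0 < n then n.factorial else 0

theorem sum_antidiagonal_posFactorial_le (n : ℕ) :
    ∑ p ∈ Finset.HasAntidiagonal.antidiagonal n, posFactorial p.1 * posFactorial p.2 ≤
      posFactorial n := by
  rcases Nat.eq_zero_or_pos n with rfl | hn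
  · simp [posFactorial]
  obtain ⟨m, rfl⟩ : ∃ m, n = m + 1 := ⟨n - 1, by omega⟩
  rw [Finset.Nat.antidiagonal_succ, Finset.sum_cons, Finset.sum_map]
  have h0 : posFactorial 0 = 0 := rfl
  simp only [h0, zero_mul, zero_add]
  rw [← Finset.sum_erase (a := (m, 0)) _ (by simp [h0])]
  calc _ ≤ ∑ p ∈ (Finset.HasAntidiagonal.antidiagonal m).erase (m, 0), m.factorial := by
        refine Finset.sum_le_sum ?_
        rintro ⟨i, j⟩ hp
        simp only [Finset.mem_erase, Finset.HasAntidiagonal.mem_antidiagonal, ne_eq,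
          Prod.mk.injEq] at hp
        have hj : 0 < j := by omega
        have := factorial_mul_factorial_le (Nat.succ_pos i) hj
        have e : i.succ + j - 1 = m := by omega
        rw [e] at this
        simpa [posFactorial, hj] using this
    _ = m * m.factorial := by
        rw [Finset.sum_const, Finset.card_erase_of_mem (by simp)]
        simp
    _ ≤ _ := by
        simp only [posFactorial, Nat.succ_pos, if_true, Nat.factorial_succ]
        exact Nat.mul_le_mul_right _ (by omega)

theorem sum_antidiagonalTuple_prod_posFactorial_le (v n : ℕ) :
    ∑ b ∈ Finset.Nat.antidiagonalTuple (v + 1) n, ∏ k, posFactorial (b k) ≤ posFactorial n := by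
  induction v generalizing n with
  | zero => simp
  | succ v ih =>
    rw [sum_antidiagonalTuple_succ]
    simp only [Fin.prod_univ_succ (n := v + 1), Fin.cons_zero, Fin.cons_succ, ← Finset.mul_sum]
    exact (Finset.sum_le_sum fun p _ => Nat.mul_le_mul_left _ (ih p.2)).trans
      (sum_antidiagonal_posFactorial_le n)

/-- A dominated family of holomorphic functions on a disc has a holomorphic integral. -/
theorem differentiableOn_ball_integral {α : Type*} [MeasurableSpace α] {m : Measure α}
    {f : ℂ → α → ℂ} {g : α → ℝ} {c : ℂ} {R : ℝ}
    (hm : ∀ z ∈ Metric.ball c R, AEStronglyMeasurable (f z) m)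
    (hd : ∀ a, DifferentiableOn ℂ (fun z => f z a) (Metric.ball c R))
    (hb : ∀ z ∈ Metric.ball c R, ∀ a, ‖f z a‖ ≤ g a) (hg : Integrable g m) :
    DifferentiableOn ℂ (fun z => ∫ a, f z a ∂m) (Metric.ball c R) := by
  intro z₀ hz₀
  obtain ⟨ε, hε, hsub⟩ := Metric.isOpen_iff.1 Metric.isOpen_ball z₀ hz₀
  have hε2 : 0 < ε / 2 := by positivity
  have hball : ∀ z ∈ Metric.ball z₀ (ε / 2), Metric.closedBall z (ε / 4) ⊆ Metric.ball c R := by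
    intro z hz w hw
    apply hsub
    rw [Metric.mem_ball] at hz ⊢
    rw [Metric.mem_closedBall] at hw
    linarith [dist_triangle w z z₀]
  have hda : ∀ a, ∀ z ∈ Metric.ball z₀ (ε / 2), HasDerivAt (fun z => f z a)
      (deriv (fun z => f z a) z) z := by
    intro a z hz
    have hzR := hball z hz (Metric.mem_closedBall_self (by positivity))
    exact ((hd a z hzR).differentiableAt (Metric.isOpen_ball.mem_nhds hzR)).hasDerivAt
  have hz₀' : z₀ ∈ Metric.ball z₀ (ε / 2) := Metric.mem_ball_self hε2
  refine (hasDerivAt_integral_of_dominated_loc_of_deriv_le (F := f)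
    (F' := fun z a => deriv (fun z => f z a) z) (bound := fun a => g a / (ε / 4))
    (Metric.ball_mem_nhds z₀ hε2) ?_ ?_ ?_ ?_ (hg.div_const _) ?_).2.differentiableAt.differentiableWithinAt
  · filter_upwards [Metric.isOpen_ball.mem_nhds hz₀] with z hz using hm z hz
  · exact hg.mono' (hm z₀ hz₀) (Filter.Eventually.of_forall (hb z₀ hz₀))
  · have hseq : Filter.Tendsto (fun n : ℕ => ((1 / ((n : ℝ) + 1) : ℝ) : ℂ)) Filter.atTop
        (nhdsWithin 0 {0}ᶜ) := by
      refine tendsto_nhdsWithin_iff.2 ⟨?_, Filter.Eventually.of_forall fun n => ?_⟩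
      · exact (Complex.continuous_ofReal.tendsto' 0 0 Complex.ofReal_zero).comp
          tendsto_one_div_add_atTop_nhds_zero_nat
      · have : (1 / ((n : ℝ) + 1)) ≠ 0 := by positivity
        exact Complex.ofReal_ne_zero.2 this
    have hlim : ∀ a, Filter.Tendsto (fun n : ℕ =>
        (((1 / ((n : ℝ) + 1) : ℝ) : ℂ))⁻¹ • (f (z₀ + ((1 / ((n : ℝ) + 1) : ℝ) : ℂ)) a - f z₀ a))
        Filter.atTop (nhds (deriv (fun z => f z a) z₀)) := fun a =>
      (hda a z₀ hz₀').tendsto_slope_zero.comp hseq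
    have hev : ∀ᶠ n : ℕ in Filter.atTop,
        z₀ + ((1 / ((n : ℝ) + 1) : ℝ) : ℂ) ∈ Metric.ball c R := by
      have h1 : Filter.Tendsto (fun n : ℕ => z₀ + ((1 / ((n : ℝ) + 1) : ℝ) : ℂ)) Filter.atTop
          (nhds (z₀ + 0)) := tendsto_const_nhds.add (tendsto_nhdsWithin_iff.1 hseq).1
      rw [add_zero] at h1
      exact h1 (Metric.isOpen_ball.mem_nhds hz₀)
    obtain ⟨N, hN⟩ := Filter.eventually_atTop.1 hev
    refine aestronglyMeasurable_of_tendsto_ae (Filter.atTop (α := ℕ)) (f := fun n a =>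
        (((1 / (((n + N : ℕ) : ℝ) + 1) : ℝ) : ℂ))⁻¹ •
          (f (z₀ + ((1 / (((n + N : ℕ) : ℝ) + 1) : ℝ) : ℂ)) a - f z₀ a)) ?_ ?_
    · intro n
      exact ((hm _ (hN (n + N) (Nat.le_add_left N n))).sub (hm z₀ hz₀)).const_smul
        (((1 / (((n + N : ℕ) : ℝ) + 1) : ℝ) : ℂ))⁻¹
    · exact Filter.Eventually.of_forall fun a => (Filter.tendsto_add_atTop_iff_nat N).2 (hlim a)
  · refine Filter.Eventually.of_forall fun a z hz => ?_
    refine Complex.norm_deriv_le_of_forall_mem_sphere_norm_le (by positivity)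
      (((hd a).mono (hball z hz)).diffContOnCl_ball le_rfl) fun w hw => ?_
    exact hb w (hball z hz (Metric.sphere_subset_closedBall hw)) a
  · exact Filter.Eventually.of_forall hda

theorem eventually_deriv_eq_ofReal_deriv {F : ℂ → ℂ} {f : ℝ → ℝ} {x₀ r : ℝ} (hr : 0 < r)
    (hF : DifferentiableOn ℂ F (Metric.ball (x₀ : ℂ) r))
    (hf : ∀ᶠ x : ℝ in nhds x₀, F x = f x) :
    ∀ᶠ x : ℝ in nhds x₀, deriv F x = ((deriv f x : ℝ) : ℂ) := by
  have hmem : ∀ᶠ x : ℝ in nhds x₀, (x : ℂ) ∈ Metric.ball (x₀ : ℂ) r :=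
    Complex.continuous_ofReal.continuousAt (Metric.ball_mem_nhds _ hr)
  filter_upwards [hf.eventually_nhds, hmem] with x hx hxr
  have h1 : HasDerivAt (fun y : ℝ => F y) (deriv F x) x :=
    ((hF x hxr).differentiableAt (Metric.isOpen_ball.mem_nhds hxr)).hasDerivAt.comp_ofReal
  have h2 : HasDerivAt (fun y : ℝ => ((f y : ℝ) : ℂ)) (deriv F x) x :=
    h1.congr_of_eventuallyEq (hx.mono fun y hy => hy.symm)
  have h3 : HasDerivAt f (deriv F x).re x := by
    exact Complex.reCLM.hasFDerivAt.comp_hasDerivAt x h2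
  rw [h3.deriv]
  exact h2.unique h3.ofReal_comp

/-- Cauchy estimates for the real derivatives of a function with a holomorphic extension. -/
theorem abs_iteratedDeriv_le_of_holomorphic_extension {F : ℂ → ℂ} {f : ℝ → ℝ} {x₀ r s M : ℝ}
    (hs : 0 < s) (hsr : s < r) (hF : DifferentiableOn ℂ F (Metric.ball (x₀ : ℂ) r))
    (hf : ∀ᶠ x : ℝ in nhds x₀, F x = f x)
    (hM : ∀ z ∈ Metric.closedBall (x₀ : ℂ) s, ‖F z‖ ≤ M) (l : ℕ) :
    |iteratedDeriv l f x₀| ≤ l.factorial * M / s ^ l := by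
  have hr : 0 < r := hs.trans hsr
  have key : ∀ (l : ℕ) (F : ℂ → ℂ) (f : ℝ → ℝ), DifferentiableOn ℂ F (Metric.ball (x₀ : ℂ) r) →
      (∀ᶠ x : ℝ in nhds x₀, F x = f x) →
      iteratedDeriv l F x₀ = ((iteratedDeriv l f x₀ : ℝ) : ℂ) := by
    intro l
    induction l with
    | zero => intro F f _ hf; simpa using hf.self_of_nhds
    | succ l ih =>
      intro F f hF hf
      rw [iteratedDeriv_succ', iteratedDeriv_succ']
      exact ih _ _ (hF.deriv Metric.isOpen_ball) (eventually_deriv_eq_ofReal_deriv hr hF hf)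
  rw [← Real.norm_eq_abs, ← Complex.norm_real, ← key l F f hF hf]
  exact Complex.norm_iteratedDeriv_le_of_forall_mem_sphere_norm_le l hs
    ((hF.mono (Metric.closedBall_subset_ball hsr)).diffContOnCl_ball le_rfl)
    fun z hz => hM z (Metric.sphere_subset_closedBall hz)

local notation "E4" => EuclideanSpace ℝ (Fin 4)

theorem mfc_pos : 0 < mfc := by
  unfold mfc
  positivity

theorem mfc_lt : mfc < 1 / 144 := by
  unfold mfc
  have := Real.pi_gt_three
  apply one_div_lt_one_div_of_lt (by norm_num)
  nlinarith

theorem integral_gaussian_eq_mfc :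
    (1 / (2 * Real.pi) ^ 4) * ∫ q : E4, Real.exp (-‖q‖ ^ 2) = mfc := by
  have h := GaussianFourier.integral_rexp_neg_mul_sq_norm (V := E4) one_pos
  have e : (Real.pi / 1) ^ ((Module.finrank ℝ E4 : ℝ) / 2) = Real.pi ^ 2 := by
    rw [finrank_euclideanSpace_fin, div_one, ← Real.rpow_natCast]
    norm_num
  simp only [neg_mul, one_mul] at h
  rw [h, e, mfc]
  have := Real.pi_ne_zero
  field_simp
  norm_num

theorem integrable_gaussian : Integrable (fun q : E4 => Real.exp (-‖q‖ ^ 2)) := by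
  by_contra h
  have h1 := integral_gaussian_eq_mfc
  rw [integral_undef h, mul_zero] at h1
  exact mfc_pos.ne h1

theorem cutoffProp_nonneg {γ : ℝ} (h1 : γ ≤ 1) (q : E4) : 0 ≤ cutoffProp γ q :=
  intervalIntegral.integral_nonneg h1 fun _ _ => (Real.exp_pos _).le

theorem cutoffProp_le {γ : ℝ} (h0 : 0 ≤ γ) (h1 : γ ≤ 1) (q : E4) :
    cutoffProp γ q ≤ 1 - γ := by
  have := intervalIntegral.norm_integral_le_of_norm_le_const (a := γ) (b := 1) (C := 1)
    (f := fun ζ => Real.exp (-(ζ * ‖q‖ ^ 2))) (fun ζ hζ => by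
      rw [Set.uIoc_of_le h1] at hζ
      rw [Real.norm_eq_abs, abs_of_pos (Real.exp_pos _), Real.exp_le_one_iff, neg_nonpos]
      exact mul_nonneg (h0.trans hζ.1.le) (sq_nonneg _))
  rw [one_mul, abs_of_nonneg (by linarith)] at this
  exact (le_abs_self _).trans this

theorem cutoffProp_eq {γ : ℝ} {q : E4} (hq : q ≠ 0) :
    cutoffProp γ q = (Real.exp (-(γ * ‖q‖ ^ 2)) - Real.exp (-‖q‖ ^ 2)) / ‖q‖ ^ 2 := by
  have hs : ‖q‖ ^ 2 ≠ 0 := by simpa using hq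
  have hd : ∀ x ∈ Set.uIcc γ 1, HasDerivAt (fun ζ => -Real.exp (-(ζ * ‖q‖ ^ 2)) / ‖q‖ ^ 2)
      (Real.exp (-(x * ‖q‖ ^ 2))) x := by
    intro x _
    have h := (((hasDerivAt_id x).mul_const (‖q‖ ^ 2)).neg.exp.neg).div_const (‖q‖ ^ 2)
    convert! h using 1
    simp only [id]
    field_simp
    simp [mul_comm]
  rw [cutoffProp, intervalIntegral.integral_eq_sub_of_hasDerivAt hd
    (Continuous.intervalIntegrable (by fun_prop) _ _), one_mul]
  ring

/-- The cutoff propagator as an analytic function of the flow parameter,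
with `s` standing for `|q|²`. -/
noncomputable def complexProp (z : ℂ) (s : ℝ) : ℂ :=
  (Complex.exp (-(Complex.exp (-z) * s)) - Complex.exp (-s)) / s

theorem cutoffProp_eq_complexProp {x : ℝ} {q : E4} (hq : q ≠ 0) :
    (cutoffProp (Real.exp (-x)) q : ℂ) = complexProp x (‖q‖ ^ 2) := by
  rw [cutoffProp_eq hq, complexProp]
  push_cast
  rfl

theorem norm_exp_mul_sub_exp_le {a b : ℂ} (ha : 0 ≤ a.re) (hb : 0 ≤ b.re) {s : ℝ} (hs : 0 ≤ s) :
    ‖Complex.exp (-(a * s)) - Complex.exp (-(b * s))‖ ≤ s * ‖a - b‖ := by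
  have hconv : Convex ℝ {w : ℂ | 0 ≤ w.re} := convex_halfSpace_re_ge 0
  refine hconv.norm_image_sub_le_of_norm_hasDerivWithin_le (f := fun w => Complex.exp (-(w * s)))
    (f' := fun w => Complex.exp (-(w * s)) * -(1 * s)) (fun w _ => ?_) (fun w hw => ?_) hb ha
  · exact (((hasDerivAt_id w).mul_const (s : ℂ)).neg.cexp).hasDerivWithinAt
  · have hw' : 0 ≤ w.re := hw
    rw [norm_mul, Complex.norm_exp, norm_neg, one_mul, Complex.norm_real, Real.norm_eq_abs,
      abs_of_nonneg hs]
    have : Real.exp (-(w * s)).re ≤ 1 := by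
      rw [Real.exp_le_one_iff]
      simp only [Complex.neg_re, Complex.re_mul_ofReal]
      have := mul_nonneg hw' hs
      linarith
    nlinarith

theorem norm_complexProp_le {z : ℂ} (hre : -1 ≤ z.re) (him : |z.im| ≤ 1) {s : ℝ} (hs : 0 ≤ s) :
    ‖complexProp z s‖ ≤ 4 := by
  have hcos : 0 ≤ (Complex.exp (-z)).re := by
    rw [Complex.exp_re]
    refine mul_nonneg (Real.exp_pos _).le (Real.cos_nonneg_of_neg_pi_div_two_le_of_le ?_ ?_) <;>
    · have := Real.pi_gt_three
      have := abs_le.1 him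
      simp only [Complex.neg_im]
      linarith
  have hnorm : ‖Complex.exp (-z) - 1‖ ≤ 4 := by
    refine (norm_sub_le _ _).trans ?_
    rw [Complex.norm_exp, norm_one, Complex.neg_re]
    have : Real.exp (-z.re) ≤ Real.exp 1 := Real.exp_le_exp.2 (by linarith)
    linarith [Real.exp_one_lt_d9]
  have h := norm_exp_mul_sub_exp_le hcos (b := 1) (by simp) hs
  rw [one_mul] at h
  rw [complexProp, norm_div, Complex.norm_real, Real.norm_eq_abs, abs_of_nonneg hs]
  exact div_le_of_le_mul₀ hs (by norm_num) (h.trans (by nlinarith))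

/-- The integrand of the fluctuation integrals, analytically continued. -/
noncomputable def complexIntegrand (v : ℕ) (D z : ℂ) (q : E4) : ℂ :=
  (Real.exp (-‖q‖ ^ 2) : ℂ) * complexProp z (‖q‖ ^ 2) ^ v *
    ((1 - D * complexProp z (‖q‖ ^ 2)) ^ (2 + v))⁻¹

/-- The fluctuation integrals, analytically continued in the flow parameter. -/
noncomputable def complexJ (Δ : ℂ → ℂ) (v : ℕ) (z : ℂ) : ℂ :=
  ((1 / (2 * Real.pi) ^ 4 : ℝ) : ℂ) * ∫ q : E4, complexIntegrand v (Δ z) z q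

theorem complexJ_ofReal {Δ : ℂ → ℂ} {δ : ℝ → ℝ} {x : ℝ} (h : Δ x = δ x) (v : ℕ) :
    complexJ Δ v x = Jflow δ v x := by
  rw [complexJ, Jflow, Complex.ofReal_mul, ← integral_complex_ofReal]
  congr 1
  refine integral_congr_ae ?_
  filter_upwards [(measure_eq_zero_iff_ae_notMem).1 (measure_singleton (0 : E4))] with q hq
  rw [complexIntegrand, h, ← cutoffProp_eq_complexProp hq]
  push_cast
  rfl

theorem aestronglyMeasurable_complexIntegrand (v : ℕ) (D z : ℂ) :
    AEStronglyMeasurable (complexIntegrand v D z) := by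
  refine Measurable.aestronglyMeasurable ?_
  unfold complexIntegrand complexProp
  fun_prop

theorem one_sub_norm_bounds {w : ℂ} (hw : ‖w‖ ≤ 1 / 100) : 99 / 100 ≤ ‖1 - w‖ := by
  have := norm_sub_norm_le 1 w
  rw [norm_one] at this
  linarith

theorem norm_mul_complexProp_le {D z : ℂ} (hD : ‖D‖ ≤ 1 / 400) (hre : -1 ≤ z.re)
    (him : |z.im| ≤ 1) (q : E4) : ‖D * complexProp z (‖q‖ ^ 2)‖ ≤ 1 / 100 := by
  rw [norm_mul]
  have := norm_complexProp_le hre him (sq_nonneg ‖q‖)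
  calc _ ≤ 1 / 400 * 4 := mul_le_mul hD this (norm_nonneg _) (by norm_num)
    _ = _ := by norm_num

theorem norm_complexIntegrand_le (v : ℕ) {D z : ℂ} (hD : ‖D‖ ≤ 1 / 400) (hre : -1 ≤ z.re)
    (him : |z.im| ≤ 1) (q : E4) :
    ‖complexIntegrand v D z q‖ ≤ Real.exp (-‖q‖ ^ 2) * (4 ^ v * (100 / 99) ^ (2 + v)) := by
  have h1 := norm_complexProp_le hre him (sq_nonneg ‖q‖)
  have h2 := one_sub_norm_bounds (norm_mul_complexProp_le hD hre him q)
  rw [complexIntegrand, norm_mul, norm_mul, Complex.norm_real, Real.norm_eq_abs,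
    abs_of_pos (Real.exp_pos _), mul_assoc, norm_pow, norm_inv, norm_pow]
  have h3 : (‖1 - D * complexProp z (‖q‖ ^ 2)‖ ^ (2 + v))⁻¹ ≤ (100 / 99) ^ (2 + v) := by
    rw [← inv_pow]
    refine pow_le_pow_left₀ (by positivity) ?_ _
    rw [inv_le_comm₀ (by linarith) (by norm_num)]
    norm_num
    exact h2
  gcongr

theorem re_im_of_mem_ball {x₀ : ℝ} (hx₀ : 0 ≤ x₀) {z : ℂ} (hz : z ∈ Metric.ball (x₀ : ℂ) 1) :
    -1 ≤ z.re ∧ |z.im| ≤ 1 := by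
  rw [mem_ball_iff_norm] at hz
  have h1 := (Complex.abs_re_le_norm _).trans hz.le
  have h2 := (Complex.abs_im_le_norm _).trans hz.le
  simp only [Complex.sub_re, Complex.sub_im, Complex.ofReal_re, Complex.ofReal_im,
    sub_zero] at h1 h2
  exact ⟨by linarith [(abs_le.1 h1).1], h2⟩

theorem differentiableOn_complexJ {Δ : ℂ → ℂ} {x₀ : ℝ} (hx₀ : 0 ≤ x₀)
    (hΔ : DifferentiableOn ℂ Δ (Metric.ball (x₀ : ℂ) 1))
    (hb : ∀ z ∈ Metric.ball (x₀ : ℂ) 1, ‖Δ z‖ ≤ 1 / 400) (v : ℕ) :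
    DifferentiableOn ℂ (complexJ Δ v) (Metric.ball (x₀ : ℂ) 1) := by
  refine DifferentiableOn.const_mul (differentiableOn_ball_integral
    (f := fun z q => complexIntegrand v (Δ z) z q)
    (fun z _ => aestronglyMeasurable_complexIntegrand v _ z) (fun q => ?_)
    (fun z hz q => ?_)
    (integrable_gaussian.mul_const (4 ^ v * (100 / 99) ^ (2 + v)))) _
  · have hp : Differentiable ℂ fun z => complexProp z (‖q‖ ^ 2) := by
      unfold complexProp
      fun_prop
    unfold complexIntegrand
    refine ((hp.differentiableOn.pow v).const_mul _).mul (DifferentiableOn.inv ?_ fun z hz => ?_)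
    · exact ((hΔ.mul hp.differentiableOn).const_sub 1).pow _
    · obtain ⟨hre, him⟩ := re_im_of_mem_ball hx₀ hz
      have := one_sub_norm_bounds (norm_mul_complexProp_le (hb z hz) hre him q)
      exact pow_ne_zero _ (norm_pos_iff.1 (by linarith))
  · obtain ⟨hre, him⟩ := re_im_of_mem_ball hx₀ hz
    exact norm_complexIntegrand_le v (hb z hz) hre him q

theorem norm_complexJ_le {Δ : ℂ → ℂ} {z : ℂ} (v : ℕ) (hD : ‖Δ z‖ ≤ 1 / 400) (hre : -1 ≤ z.re)
    (him : |z.im| ≤ 1) :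
    ‖complexJ Δ v z‖ ≤ mfc * (4 ^ v * (100 / 99) ^ (2 + v)) := by
  rw [complexJ, norm_mul, Complex.norm_real, Real.norm_eq_abs, abs_of_pos (by positivity),
    ← integral_gaussian_eq_mfc, mul_assoc, ← integral_mul_const]
  refine mul_le_mul_of_nonneg_left ?_ (by positivity)
  exact norm_integral_le_of_norm_le (integrable_gaussian.mul_const _)
    (Filter.Eventually.of_forall (norm_complexIntegrand_le v hD hre him))

theorem norm_inv_one_sub_sq_sub_one_le {w : ℂ} (hw : ‖w‖ ≤ 1 / 100) :
    ‖((1 - w) ^ 2)⁻¹ - 1‖ ≤ 5 / 2 * ‖w‖ := by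
  have h1 := one_sub_norm_bounds hw
  have h0 : 1 - w ≠ 0 := norm_pos_iff.1 (by linarith)
  have e : ((1 - w) ^ 2)⁻¹ - 1 = w * (2 - w) / (1 - w) ^ 2 := by
    field_simp
    ring
  rw [e, norm_div, norm_mul, norm_pow, div_le_iff₀ (by positivity)]
  have h2 : ‖2 - w‖ ≤ 2 + ‖w‖ := by
    simpa using norm_sub_le (2 : ℂ) w
  have h3 : (99 / 100 : ℝ) ^ 2 ≤ ‖1 - w‖ ^ 2 := pow_le_pow_left₀ (by norm_num) h1 2
  nlinarith [norm_nonneg w, mul_le_mul_of_nonneg_left h2 (norm_nonneg w),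
    mul_le_mul_of_nonneg_left h3 (norm_nonneg w)]

theorem norm_complexJ_zero_sub_le {Δ : ℂ → ℂ} {z : ℂ} (hD : ‖Δ z‖ ≤ 1 / 400) (hre : -1 ≤ z.re)
    (him : |z.im| ≤ 1) :
    ‖complexJ Δ 0 z - mfc‖ ≤ 10 * mfc * ‖Δ z‖ := by
  have hi : Integrable (complexIntegrand 0 (Δ z) z) :=
    (integrable_gaussian.mul_const (4 ^ 0 * (100 / 99) ^ (2 + 0))).mono'
      (aestronglyMeasurable_complexIntegrand 0 _ z)
      (Filter.Eventually.of_forall (norm_complexIntegrand_le 0 hD hre him))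
  have hg : Integrable (fun q : E4 => (Real.exp (-‖q‖ ^ 2) : ℂ)) := integrable_gaussian.ofReal
  have e : complexJ Δ 0 z - mfc = ((1 / (2 * Real.pi) ^ 4 : ℝ) : ℂ) *
      ∫ q : E4, (complexIntegrand 0 (Δ z) z q - (Real.exp (-‖q‖ ^ 2) : ℂ)) := by
    rw [integral_sub hi hg, integral_complex_ofReal, mul_sub,
      ← Complex.ofReal_mul, integral_gaussian_eq_mfc, complexJ]
  rw [e, norm_mul, Complex.norm_real, Real.norm_eq_abs, abs_of_pos (by positivity),
    show 10 * mfc * ‖Δ z‖ = mfc * (10 * ‖Δ z‖) by ring,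
    ← integral_gaussian_eq_mfc, mul_assoc, ← integral_mul_const]
  refine mul_le_mul_of_nonneg_left ?_ (by positivity)
  refine norm_integral_le_of_norm_le (integrable_gaussian.mul_const _)
    (Filter.Eventually.of_forall fun q => ?_)
  have e2 : complexIntegrand 0 (Δ z) z q - (Real.exp (-‖q‖ ^ 2) : ℂ) =
      (Real.exp (-‖q‖ ^ 2) : ℂ) * (((1 - Δ z * complexProp z (‖q‖ ^ 2)) ^ 2)⁻¹ - 1) := by
    simp only [complexIntegrand]
    ring
  rw [e2, norm_mul, Complex.norm_real, Real.norm_eq_abs, abs_of_pos (Real.exp_pos _)]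
  refine mul_le_mul_of_nonneg_left ?_ (Real.exp_pos _).le
  have h1 := norm_inv_one_sub_sq_sub_one_le (norm_mul_complexProp_le hD hre him q)
  have h2 := norm_complexProp_le hre him (sq_nonneg ‖q‖)
  rw [norm_mul] at h1
  nlinarith [norm_nonneg (Δ z)]

theorem Jflow_zero_bounds {δ : ℝ → ℝ} {μ : ℝ} (hμ : 0 ≤ μ) (h0 : 0 < δ μ) (h1 : δ μ < 1) :
    mfc ≤ Jflow δ 0 μ ∧ Jflow δ 0 μ < mfc / (1 - δ μ) ^ 2 := by
  have hγ0 : 0 < Real.exp (-μ) := Real.exp_pos _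
  have hγ1 : Real.exp (-μ) ≤ 1 := Real.exp_le_one_iff.2 (by linarith)
  set γ := Real.exp (-μ) with hγ
  set a := 1 - δ μ * (1 - γ) with ha
  have ha1 : 1 - δ μ < a := by nlinarith
  have hlow : ∀ q : E4, 1 ≤ ((1 - δ μ * cutoffProp γ q) ^ 2)⁻¹ ∧
      ((1 - δ μ * cutoffProp γ q) ^ 2)⁻¹ ≤ (a ^ 2)⁻¹ := by
    intro q
    have hc0 := cutoffProp_nonneg hγ1 q
    have hc1 := cutoffProp_le hγ0.le hγ1 q
    have hge : a ≤ 1 - δ μ * cutoffProp γ q := by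
      have := mul_le_mul_of_nonneg_left hc1 h0.le
      linarith
    have hle : 1 - δ μ * cutoffProp γ q ≤ 1 := by
      have := mul_nonneg h0.le hc0
      linarith
    have hpos : 0 < 1 - δ μ * cutoffProp γ q := by linarith
    refine ⟨(one_le_inv₀ (by positivity)).2 (pow_le_one₀ hpos.le hle), ?_⟩
    have hapos : 0 < a := by linarith
    gcongr
  have hpt : ∀ q : E4, Real.exp (-‖q‖ ^ 2) ≤ Real.exp (-‖q‖ ^ 2) * cutoffProp γ q ^ 0 *
        ((1 - δ μ * cutoffProp γ q) ^ (2 + 0))⁻¹ ∧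
      Real.exp (-‖q‖ ^ 2) * cutoffProp γ q ^ 0 * ((1 - δ μ * cutoffProp γ q) ^ (2 + 0))⁻¹ ≤
        Real.exp (-‖q‖ ^ 2) * (a ^ 2)⁻¹ := by
    intro q
    have he := Real.exp_pos (-‖q‖ ^ 2)
    rw [pow_zero, mul_one, add_zero]
    exact ⟨le_mul_of_one_le_right he.le (hlow q).1, mul_le_mul_of_nonneg_left (hlow q).2 he.le⟩
  have hmeas : AEStronglyMeasurable (fun q : E4 => Real.exp (-‖q‖ ^ 2) * cutoffProp γ q ^ 0 *
        ((1 - δ μ * cutoffProp γ q) ^ (2 + 0))⁻¹) := by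
    have hm : AEStronglyMeasurable (fun q : E4 => Real.exp (-‖q‖ ^ 2) *
        ((Real.exp (-(γ * ‖q‖ ^ 2)) - Real.exp (-‖q‖ ^ 2)) / ‖q‖ ^ 2) ^ 0 *
        ((1 - δ μ * ((Real.exp (-(γ * ‖q‖ ^ 2)) - Real.exp (-‖q‖ ^ 2)) / ‖q‖ ^ 2)) ^ (2 + 0))⁻¹) :=
      Measurable.aestronglyMeasurable (by fun_prop)
    refine hm.congr ?_
    filter_upwards [(measure_eq_zero_iff_ae_notMem).1 (measure_singleton (0 : E4))] with q hq
    rw [cutoffProp_eq hq]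
  have hcut : Integrable (fun q : E4 => Real.exp (-‖q‖ ^ 2) * cutoffProp γ q ^ 0 *
        ((1 - δ μ * cutoffProp γ q) ^ (2 + 0))⁻¹) := by
    refine (integrable_gaussian.mul_const (a ^ 2)⁻¹).mono' hmeas
      (Filter.Eventually.of_forall fun q => ?_)
    rw [Real.norm_eq_abs, abs_of_nonneg ((Real.exp_pos _).le.trans (hpt q).1)]
    exact (hpt q).2
  have hpre : 0 ≤ 1 / (2 * Real.pi) ^ 4 := by positivity
  constructor
  · rw [Jflow, ← integral_gaussian_eq_mfc]
    exact mul_le_mul_of_nonneg_left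
      (integral_mono integrable_gaussian hcut fun q => (hpt q).1) hpre
  · have h2 : Jflow δ 0 μ ≤ mfc * (a ^ 2)⁻¹ := by
      rw [Jflow, ← integral_gaussian_eq_mfc, mul_assoc, ← integral_mul_const]
      exact mul_le_mul_of_nonneg_left
        (integral_mono hcut (integrable_gaussian.mul_const _) fun q => (hpt q).2) hpre
    refine h2.trans_lt ?_
    rw [div_eq_mul_inv]
    have := mfc_pos
    have h1' : 0 < 1 - δ μ := by linarith
    gcongr

theorem eq_div_of_deriv_eq_sq {T β : ℝ} {δ : ℝ → ℝ} (hδ : Differentiable ℝ δ)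
    (hode : ∀ x ∈ Set.Icc (0 : ℝ) T, deriv δ x = β * δ x ^ 2)
    (hpos : ∀ x ∈ Set.Icc (0 : ℝ) T, 0 < δ x) {x y : ℝ} (hx : x ∈ Set.Icc (0 : ℝ) T)
    (hy : y ∈ Set.Icc (0 : ℝ) T) : δ y = δ x / (1 - β * δ x * (y - x)) := by
  have hd : ∀ t ∈ Set.Icc (0 : ℝ) T,
      HasDerivWithinAt (fun t => (δ t)⁻¹ + β * t) 0 (Set.Icc 0 T) t := by
    intro t ht
    have h0 := (hpos t ht).ne'
    have h1 := ((hδ t).hasDerivAt.inv h0).add ((hasDerivAt_id t).const_mul β)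
    rw [hode t ht] at h1
    convert! h1.hasDerivWithinAt using 1
    field_simp
    ring
  have h2 := (convex_Icc (0 : ℝ) T).norm_image_sub_le_of_norm_hasDerivWithin_le (C := 0) hd
    (fun _ _ => by simp) hx hy
  rw [zero_mul, norm_le_zero_iff, sub_eq_zero] at h2
  have h3 := hpos x hx
  have h4 := hpos y hy
  have h5 : 1 - β * δ x * (y - x) = δ x / δ y := by
    have : (δ y)⁻¹ = (δ x)⁻¹ + β * x - β * y := by linarith
    rw [div_eq_mul_inv, this]
    field_simp
    ring
  rw [h5]
  field_simp

/-- The solution of `Δ' = β Δ²` with `Δ x₀ = d`, in the complex domain. -/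
noncomputable def complexCoupling (β d x₀ : ℝ) (z : ℂ) : ℂ := d / (1 - β * d * (z - x₀))

theorem complexCoupling_aux {β d x₀ : ℝ} (hβ0 : 0 < β) (hβ : β ≤ 2) (hd0 : 0 < d)
    (hd : d ≤ mfc / 4) {z : ℂ} (hz : z ∈ Metric.ball (x₀ : ℂ) 1) :
    ‖(β : ℂ) * d * (z - x₀)‖ ≤ 2 * d ∧ 99 / 100 ≤ ‖1 - (β : ℂ) * d * (z - x₀)‖ := by
  have h1 : ‖(β : ℂ) * d * (z - x₀)‖ ≤ 2 * d := by
    rw [mem_ball_iff_norm] at hz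
    rw [norm_mul, norm_mul, Complex.norm_real, Complex.norm_real, Real.norm_eq_abs,
      Real.norm_eq_abs, abs_of_pos hβ0, abs_of_pos hd0]
    calc β * d * ‖z - x₀‖ ≤ β * d * 1 := mul_le_mul_of_nonneg_left hz.le (by positivity)
      _ ≤ 2 * d := by nlinarith
  exact ⟨h1, one_sub_norm_bounds (by linarith [mfc_lt])⟩

theorem norm_complexCoupling_le {β d x₀ : ℝ} (hβ0 : 0 < β) (hβ : β ≤ 2) (hd0 : 0 < d)
    (hd : d ≤ mfc / 4) {z : ℂ} (hz : z ∈ Metric.ball (x₀ : ℂ) 1) :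
    ‖complexCoupling β d x₀ z‖ ≤ 100 / 99 * d := by
  obtain ⟨-, h2⟩ := complexCoupling_aux hβ0 hβ hd0 hd hz
  rw [complexCoupling, norm_div, Complex.norm_real, Real.norm_eq_abs, abs_of_pos hd0,
    div_le_iff₀ (by linarith)]
  nlinarith

theorem norm_complexCoupling_sub_le {β d x₀ : ℝ} (hβ0 : 0 < β) (hβ : β ≤ 2) (hd0 : 0 < d)
    (hd : d ≤ mfc / 4) {z : ℂ} (hz : z ∈ Metric.ball (x₀ : ℂ) 1) :
    ‖complexCoupling β d x₀ z - d‖ ≤ 200 / 99 * d ^ 2 := by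
  obtain ⟨h1, h2⟩ := complexCoupling_aux hβ0 hβ hd0 hd hz
  have h0 : 1 - (β : ℂ) * d * (z - x₀) ≠ 0 := norm_pos_iff.1 (by linarith)
  have e : complexCoupling β d x₀ z - d =
      complexCoupling β d x₀ z * (β * d * (z - x₀)) := by
    have h3 : complexCoupling β d x₀ z * (1 - β * d * (z - x₀)) = d := div_mul_cancel₀ _ h0
    linear_combination h3
  rw [e, norm_mul]
  calc _ ≤ 100 / 99 * d * (2 * d) :=
        mul_le_mul (norm_complexCoupling_le hβ0 hβ hd0 hd hz) h1 (norm_nonneg _) (by positivity)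
    _ = _ := by ring

theorem differentiableOn_complexCoupling {β d x₀ : ℝ} (hβ0 : 0 < β) (hβ : β ≤ 2) (hd0 : 0 < d)
    (hd : d ≤ mfc / 4) :
    DifferentiableOn ℂ (complexCoupling β d x₀) (Metric.ball (x₀ : ℂ) 1) := by
  unfold complexCoupling
  refine DifferentiableOn.div (by fun_prop) (by fun_prop) fun z hz => ?_
  obtain ⟨-, h2⟩ := complexCoupling_aux hβ0 hβ hd0 hd hz
  exact norm_pos_iff.1 (by linarith)

theorem norm_complexCoupling_le_const {β d x₀ : ℝ} (hβ0 : 0 < β) (hβ : β ≤ 2) (hd0 : 0 < d)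
    (hd : d ≤ mfc / 4) {z : ℂ} (hz : z ∈ Metric.ball (x₀ : ℂ) 1) :
    ‖complexCoupling β d x₀ z‖ ≤ 1 / 400 :=
  (norm_complexCoupling_le hβ0 hβ hd0 hd hz).trans (by linarith [mfc_lt])

/-- The fluctuation integrals continued along the complex coupling. -/
noncomputable def flowJ (β d x₀ : ℝ) (v : ℕ) (z : ℂ) : ℂ :=
  complexJ (complexCoupling β d x₀) v z

section FlowJ

variable {β d x₀ : ℝ} (hx₀ : 0 ≤ x₀) (hβ0 : 0 < β) (hβ : β ≤ 2) (hd0 : 0 < d)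
  (hd : d ≤ mfc / 4) {z : ℂ} (hz : z ∈ Metric.ball (x₀ : ℂ) 1)

include hx₀ hβ0 hβ hd0 hd

theorem differentiableOn_flowJ (v : ℕ) :
    DifferentiableOn ℂ (flowJ β d x₀ v) (Metric.ball (x₀ : ℂ) 1) :=
  differentiableOn_complexJ hx₀ (differentiableOn_complexCoupling hβ0 hβ hd0 hd)
    (fun _ hz => norm_complexCoupling_le_const hβ0 hβ hd0 hd hz) v

include hz

theorem norm_flowJ_le (v : ℕ) :
    ‖flowJ β d x₀ v z‖ ≤ mfc * (4 ^ v * (100 / 99) ^ (2 + v)) := by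
  obtain ⟨hre, him⟩ := re_im_of_mem_ball hx₀ hz
  exact norm_complexJ_le v (norm_complexCoupling_le_const hβ0 hβ hd0 hd hz) hre him

theorem norm_flowJ_zero_sub_le : ‖flowJ β d x₀ 0 z - mfc‖ ≤ 1000 / 99 * mfc * d := by
  obtain ⟨hre, him⟩ := re_im_of_mem_ball hx₀ hz
  have h := norm_complexJ_zero_sub_le (norm_complexCoupling_le_const hβ0 hβ hd0 hd hz) hre him
  refine h.trans ?_
  have h2 := norm_complexCoupling_le hβ0 hβ hd0 hd hz
  have := mul_le_mul_of_nonneg_left h2 (a := 10 * mfc) (by linarith [mfc_pos])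
  linarith

theorem le_norm_flowJ_zero : 49 / 50 * mfc ≤ ‖flowJ β d x₀ 0 z‖ := by
  have h := norm_flowJ_zero_sub_le hx₀ hβ0 hβ hd0 hd hz
  have h2 := norm_sub_norm_le (mfc : ℂ) (flowJ β d x₀ 0 z)
  rw [norm_sub_rev, Complex.norm_real, Real.norm_eq_abs, abs_of_pos mfc_pos] at h2
  have h3 : mfc * d ≤ mfc * (1 / 576) :=
    mul_le_mul_of_nonneg_left (by linarith [mfc_lt]) mfc_pos.le
  have := mfc_pos
  linarith

theorem flowJ_zero_ne_zero : flowJ β d x₀ 0 z ≠ 0 :=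
  norm_pos_iff.1 (lt_of_lt_of_le (by linarith [mfc_pos])
    (le_norm_flowJ_zero hx₀ hβ0 hβ hd0 hd hz))

theorem norm_inv_flowJ_zero_le : ‖(flowJ β d x₀ 0 z)⁻¹‖ ≤ 11 / 10 / mfc := by
  have h := le_norm_flowJ_zero hx₀ hβ0 hβ hd0 hd hz
  have := mfc_pos
  rw [norm_inv, inv_le_comm₀ (by linarith) (by positivity), inv_div]
  linarith

end FlowJ

/-- `H` continues `f` holomorphically around `x₀`, with the growth expected of the
`(b+2)`-point function at coupling `d`. The derivatives gain a power of `d`, hence the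
subtraction of `κ`, which only matters for the four-point function. -/
structure GrowthExtension (x₀ d : ℝ) (b : ℕ) (f : ℝ → ℝ) (H : ℂ → ℂ) (κ : ℝ) : Prop where
  diff : DifferentiableOn ℂ H (Metric.ball (x₀ : ℂ) 1)
  agree : ∀ᶠ x : ℝ in nhds x₀, H x = f x
  norm_le : ∀ z ∈ Metric.ball (x₀ : ℂ) (1 / 2 + 1 / b),
    ‖H z‖ ≤ 4 * mfc * d * ((2 * mfc)⁻¹ ^ b * b.factorial)
  norm_sub_le : ∀ z ∈ Metric.ball (x₀ : ℂ) (1 / 2 + 1 / b),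
    ‖H z - κ‖ ≤ 16 * d ^ 2 * ((2 * mfc)⁻¹ ^ b * b.factorial)
  eq_zero : b ≠ 2 → κ = 0

theorem ball_half_add_inv_subset (x : ℂ) {b : ℕ} (hb : 2 ≤ b) :
    Metric.ball x (1 / 2 + 1 / (b : ℝ)) ⊆ Metric.ball x 1 := by
  refine Metric.ball_subset_ball ?_
  have hb' : (2 : ℝ) ≤ b := by exact_mod_cast hb
  have := one_div_le_one_div_of_le (by norm_num) hb'
  linarith

theorem GrowthExtension.norm_deriv_le {x₀ d : ℝ} {b : ℕ} {f : ℝ → ℝ} {H : ℂ → ℂ} {κ : ℝ}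
    (h : GrowthExtension x₀ d b f H κ) (hb : 2 ≤ b) {z : ℂ}
    (hz : z ∈ Metric.ball (x₀ : ℂ) (1 / 2 + 1 / ((b + 2 : ℕ) : ℝ))) :
    ‖deriv H z‖ ≤ 16 * d ^ 2 * ((2 * mfc)⁻¹ ^ b * b.factorial) * (b * (b + 2) / 2) := by
  have hb' : (2 : ℝ) ≤ b := by exact_mod_cast hb
  have hsub : Metric.closedBall z (2 / (b * (b + 2))) ⊆
      Metric.ball (x₀ : ℂ) (1 / 2 + 1 / (b : ℝ)) := by
    intro w hw
    rw [Metric.mem_closedBall] at hw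
    rw [Metric.mem_ball] at hz ⊢
    have e : 1 / (b : ℝ) = 1 / ((b + 2 : ℕ) : ℝ) + 2 / (b * (b + 2)) := by
      push_cast
      field_simp
    linarith [dist_triangle w z (x₀ : ℂ)]
  have h1 := Complex.norm_deriv_le_of_forall_mem_sphere_norm_le (f := fun z => H z - κ)
    (c := z) (R := 2 / (b * (b + 2))) (by positivity)
    (((h.diff.mono (hsub.trans (ball_half_add_inv_subset _ hb))).sub_const _).diffContOnCl_ball
      le_rfl)
    (fun w hw => h.norm_sub_le w (hsub (Metric.sphere_subset_closedBall hw)))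
  rw [deriv_sub_const] at h1
  refine h1.trans (le_of_eq ?_)
  field_simp

/-- The quadratic and higher terms of the hierarchy, for a family `J` of vertex weights and
correlation functions `H`. -/
noncomputable def treeSum {R : Type*} [CommRing R] (n : ℕ) (J : ℕ → R) (H : ℕ → R) : R :=
  ∑ v ∈ Finset.Icc 2 (n / 2), (-1 : R) ^ v * J (v - 1) *
    ∑ b ∈ (Finset.Nat.antidiagonalTuple v n).filter (fun b => ∀ k, Even (b k) ∧ 0 < b k),
      ∏ k, H (b k)

theorem mem_range_of_mem_filter_antidiagonalTuple {v n : ℕ} (hv : 2 ≤ v) {b : Fin v → ℕ}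
    (hb : b ∈ (Finset.Nat.antidiagonalTuple v n).filter (fun b => ∀ k, Even (b k) ∧ 0 < b k))
    (k : Fin v) : b k < n ∧ Even (b k) ∧ 2 ≤ b k := by
  rw [Finset.mem_filter, Finset.Nat.mem_antidiagonalTuple] at hb
  obtain ⟨hs, hb⟩ := hb
  refine ⟨?_, (hb k).1, ?_⟩
  · have : Nontrivial (Fin v) := Fin.nontrivial_iff_two_le.2 hv
    obtain ⟨j, hj⟩ := exists_ne k
    have h1 : b k + b j ≤ ∑ i, b i := by
      rw [← Finset.sum_pair hj.symm]
      exact Finset.sum_le_sum_of_subset (Finset.subset_univ _)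
    have := (hb j).2
    omega
  · obtain ⟨m, hm⟩ := (hb k).1
    have := (hb k).2
    omega

theorem treeSum_congr {R : Type*} [CommRing R] {n : ℕ} {J J' H H' : ℕ → R}
    (hJ : ∀ v, J v = J' v) (hH : ∀ b < n, Even b → 2 ≤ b → H b = H' b) :
    treeSum n J H = treeSum n J' H' := by
  refine Finset.sum_congr rfl fun v hv => ?_
  rw [hJ]
  congr 1
  refine Finset.sum_congr rfl fun b hb => Finset.prod_congr rfl fun k _ => ?_
  obtain ⟨h1, h2, h3⟩ := mem_range_of_mem_filter_antidiagonalTuple (Finset.mem_Icc.1 hv).1 hb k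
  exact hH _ h1 h2 h3

theorem ofReal_treeSum (n : ℕ) (J H : ℕ → ℝ) :
    ((treeSum n J H : ℝ) : ℂ) = treeSum n (fun v => (J v : ℂ)) (fun b => (H b : ℂ)) := by
  simp [treeSum]

theorem differentiableOn_treeSum {s : Set ℂ} {n : ℕ} {J H : ℕ → ℂ → ℂ}
    (hJ : ∀ v, DifferentiableOn ℂ (J v) s)
    (hH : ∀ b < n, Even b → 2 ≤ b → DifferentiableOn ℂ (H b) s) :
    DifferentiableOn ℂ (fun z => treeSum n (fun v => J v z) (fun b => H b z)) s := by
  unfold treeSum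
  refine DifferentiableOn.fun_sum fun v hv => ((hJ _).const_mul _).mul ?_
  refine DifferentiableOn.fun_sum fun b hb => DifferentiableOn.fun_finsetProd fun k _ => ?_
  obtain ⟨h1, h2, h3⟩ := mem_range_of_mem_filter_antidiagonalTuple (Finset.mem_Icc.1 hv).1 hb k
  exact hH _ h1 h2 h3

theorem norm_sum_prod_le {v n : ℕ} (hv : 2 ≤ v) {H : ℕ → ℂ} {a Q : ℝ} (ha : 0 ≤ a) (hQ : 0 ≤ Q)
    (hH : ∀ b < n, Even b → 2 ≤ b → ‖H b‖ ≤ a * (Q ^ b * b.factorial)) :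
    ‖∑ b ∈ (Finset.Nat.antidiagonalTuple v n).filter (fun b => ∀ k, Even (b k) ∧ 0 < b k),
      ∏ k, H (b k)‖ ≤ a ^ v * (Q ^ n * n.factorial) := by
  have h1 : ∀ b ∈ (Finset.Nat.antidiagonalTuple v n).filter (fun b => ∀ k, Even (b k) ∧ 0 < b k),
      ‖∏ k, H (b k)‖ ≤ a ^ v * Q ^ n * ((∏ k, posFactorial (b k) : ℕ) : ℝ) := by
    intro b hb
    have hmem := mem_range_of_mem_filter_antidiagonalTuple hv hb
    rw [Finset.mem_filter, Finset.Nat.mem_antidiagonalTuple] at hb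
    rw [norm_prod]
    calc ∏ k, ‖H (b k)‖ ≤ ∏ k, (a * (Q ^ b k * (posFactorial (b k) : ℝ))) := by
          refine Finset.prod_le_prod (fun _ _ => norm_nonneg _) fun k _ => ?_
          obtain ⟨h1, h2, h3⟩ := hmem k
          have : posFactorial (b k) = (b k).factorial := if_pos (by omega)
          rw [this]
          exact hH _ h1 h2 h3
      _ = _ := by
          rw [Finset.prod_mul_distrib, Finset.prod_mul_distrib, Finset.prod_pow_eq_pow_sum, hb.1]
          simp [mul_assoc]
  obtain ⟨w, rfl⟩ : ∃ w, v = w + 1 := ⟨v - 1, by omega⟩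
  have h2 : ∑ b ∈ (Finset.Nat.antidiagonalTuple (w + 1) n).filter
      (fun b => ∀ k, Even (b k) ∧ 0 < b k), ∏ k, posFactorial (b k) ≤ n.factorial := by
    refine (Finset.sum_le_sum_of_subset (Finset.filter_subset _ _)).trans
      ((sum_antidiagonalTuple_prod_posFactorial_le w n).trans ?_)
    unfold posFactorial
    split_ifs <;> omega
  refine (norm_sum_le_of_le _ h1).trans ?_
  rw [← Finset.mul_sum, mul_assoc]
  gcongr
  exact_mod_cast h2

theorem norm_treeSum_le {n : ℕ} {J H : ℕ → ℂ} {d : ℝ} (hd0 : 0 < d) (hd : d ≤ mfc / 4)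
    (hJ : ∀ v, ‖J v‖ ≤ mfc * (4 ^ v * (100 / 99) ^ (2 + v)))
    (hH : ∀ b < n, Even b → 2 ≤ b →
      ‖H b‖ ≤ 4 * mfc * d * ((2 * mfc)⁻¹ ^ b * b.factorial)) :
    ‖treeSum n J H‖ ≤ mfc * d ^ 2 * ((2 * mfc)⁻¹ ^ n * n.factorial) := by
  have hc := mfc_pos
  have hc2 := mfc_lt
  set G : ℝ := (2 * mfc)⁻¹ ^ n * n.factorial with hG
  have hG0 : 0 ≤ G := by positivity
  have hterm : ∀ v ∈ Finset.Icc 2 (n / 2), ‖(-1 : ℂ) ^ v * J (v - 1) *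
      ∑ b ∈ (Finset.Nat.antidiagonalTuple v n).filter (fun b => ∀ k, Even (b k) ∧ 0 < b k),
        ∏ k, H (b k)‖ ≤ mfc * G * (20 * mfc * d) ^ v := by
    intro v hv
    have hv2 := (Finset.mem_Icc.1 hv).1
    obtain ⟨w, rfl⟩ : ∃ w, v = w + 1 := ⟨v - 1, by omega⟩
    rw [norm_mul, norm_mul, norm_pow, norm_neg, norm_one, one_pow, one_mul]
    have h1 := norm_sum_prod_le hv2 (by positivity) (by positivity) hH
    have h2 := mul_le_mul (hJ (w + 1 - 1)) h1 (norm_nonneg _) (by positivity)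
    refine h2.trans ?_
    rw [Nat.add_sub_cancel, ← hG]
    have h3 : (4 : ℝ) ^ w * (100 / 99) ^ (2 + w) ≤ 5 ^ (w + 1) := by
      have : ((4 : ℝ) * (100 / 99)) ^ w ≤ 5 ^ w := pow_le_pow_left₀ (by norm_num) (by norm_num) w
      rw [mul_pow] at this
      rw [pow_add, pow_succ (5 : ℝ)]
      have : 0 ≤ (4 : ℝ) ^ w * (100 / 99) ^ w := by positivity
      linarith
    have e : (20 * mfc * d) ^ (w + 1) = 5 ^ (w + 1) * (4 * mfc * d) ^ (w + 1) := by
      rw [← mul_pow]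
      ring
    rw [e]
    have : 0 ≤ mfc * G * (4 * mfc * d) ^ (w + 1) := by positivity
    nlinarith [mul_le_mul_of_nonneg_right h3 this]
  refine (norm_sum_le_of_le _ hterm).trans ?_
  rw [← Finset.mul_sum]
  have hx0 : 0 ≤ 20 * mfc * d := by positivity
  have hmd : mfc * d ≤ 1 / 144 * (1 / 576) :=
    mul_le_mul hc2.le (by linarith) hd0.le (by norm_num)
  have hsum : ∑ v ∈ Finset.Icc 2 (n / 2), (20 * mfc * d) ^ v ≤
      (20 * mfc * d) ^ 2 / (1 - 20 * mfc * d) := by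
    have : Finset.Icc 2 (n / 2) = Finset.Ico 2 (n / 2 + 1) := by
      ext
      simp
    rw [this]
    exact geom_sum_Ico_le_of_lt_one hx0 (by linarith)
  have h4 : (20 * mfc * d) ^ 2 / (1 - 20 * mfc * d) ≤ d ^ 2 := by
    rw [div_le_iff₀ (by linarith)]
    have h5 : 400 * mfc ^ 2 ≤ 1 - 20 * mfc * d := by nlinarith
    nlinarith [mul_le_mul_of_nonneg_left h5 (sq_nonneg d)]
  calc _ ≤ mfc * G * d ^ 2 := mul_le_mul_of_nonneg_left (hsum.trans h4) (by positivity)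
    _ = _ := by ring

theorem OnePIHierarchy.four_eq {T : ℝ} {δ : ℝ → ℝ} {h : ℕ → ℝ → ℝ} (hh : OnePIHierarchy T δ h)
    {β x : ℝ} (hx : x ∈ Set.Icc 0 T) (hode : deriv δ x = β * δ x ^ 2) :
    Jflow δ 0 x * h 4 x = δ x - β * δ x ^ 2 := by
  obtain ⟨-, h2, heq⟩ := hh
  have h3 := heq 2 even_two le_rfl x hx
  have e : h 2 = fun y => -δ y := funext h2
  rw [e, deriv.fun_neg, hode] at h3
  norm_num at h3
  linarith

theorem OnePIHierarchy.eq_treeSum {T : ℝ} {δ : ℝ → ℝ} {h : ℕ → ℝ → ℝ} (hh : OnePIHierarchy T δ h)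
    {n : ℕ} (hn : Even n) (hn2 : 2 ≤ n) {x : ℝ} (hx : x ∈ Set.Icc 0 T) :
    Jflow δ 0 x * h (n + 2) x =
      treeSum n (fun v => Jflow δ v x) (fun b => h (b + 2) x)
      + (2 / ((n : ℝ) * ((n : ℝ) - 1))) * deriv (h n) x
      + (((n : ℝ) - 4) / ((n : ℝ) * ((n : ℝ) - 1))) * h n x := by
  rw [hh.2.2 n hn hn2 x hx]
  simp only [treeSum, Finset.sum_filter]

section Extension

variable {T β : ℝ} {δ : ℝ → ℝ} {h : ℕ → ℝ → ℝ} {x₀ : ℝ} (hβ0 : 0 < β) (hβ : β ≤ 2)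
  (hδ : Differentiable ℝ δ) (hode : ∀ x ∈ Set.Icc (0 : ℝ) T, deriv δ x = β * δ x ^ 2)
  (hpos : ∀ x ∈ Set.Icc (0 : ℝ) T, 0 < δ x) (hle : ∀ x ∈ Set.Icc (0 : ℝ) T, δ x ≤ mfc / 4)
  (hh : OnePIHierarchy T δ h) (hx₀ : x₀ ∈ Set.Ioo 0 T)

include hδ hode hpos hx₀

theorem eventually_coupling_eq :
    ∀ᶠ x : ℝ in nhds x₀, x ∈ Set.Icc 0 T ∧ (x : ℂ) ∈ Metric.ball (x₀ : ℂ) 1 ∧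
      complexCoupling β (δ x₀) x₀ x = δ x ∧ ∀ v, flowJ β (δ x₀) x₀ v x = Jflow δ v x := by
  have hmem : ∀ᶠ x : ℝ in nhds x₀, (x : ℂ) ∈ Metric.ball (x₀ : ℂ) 1 :=
    Complex.continuous_ofReal.continuousAt (Metric.ball_mem_nhds _ one_pos)
  filter_upwards [Ioo_mem_nhds hx₀.1 hx₀.2, hmem] with x hx hx1
  have hx' := Set.Ioo_subset_Icc_self hx
  have e : complexCoupling β (δ x₀) x₀ x = δ x := by
    rw [eq_div_of_deriv_eq_sq hδ hode hpos (Set.Ioo_subset_Icc_self hx₀) hx', complexCoupling]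
    push_cast
    rfl
  exact ⟨hx', hx1, e, fun v => complexJ_ofReal e v⟩

include hβ0 hβ hle hh

theorem growthExtension_four :
    ∃ H, GrowthExtension x₀ (δ x₀) 2 (h 4) H (δ x₀ / mfc) := by
  have hx₀' := Set.Ioo_subset_Icc_self hx₀
  have hd0 := hpos x₀ hx₀'
  have hd := hle x₀ hx₀'
  have hc := mfc_pos
  have hc2 := mfc_lt
  have hev := eventually_coupling_eq (β := β) hδ hode hpos hx₀
  set d := δ x₀ with hd_def
  set Δ := complexCoupling β d x₀ with hΔ
  have hsub := ball_half_add_inv_subset (x₀ : ℂ) (le_refl 2)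
  have hfac : ((2 * mfc)⁻¹ ^ 2 * (Nat.factorial 2 : ℝ)) = 1 / (2 * mfc ^ 2) := by
    norm_num [Nat.factorial]
    field_simp
  have hβn : ‖(β : ℂ)‖ ≤ 2 := by
    rwa [Complex.norm_real, Real.norm_eq_abs, abs_of_pos hβ0]
  refine ⟨fun z => (flowJ β d x₀ 0 z)⁻¹ * (Δ z - β * Δ z ^ 2), ?_, ?_, ?_, ?_,
    fun h => absurd rfl h⟩
  · have h1 := differentiableOn_complexCoupling (x₀ := x₀) hβ0 hβ hd0 hd
    exact ((differentiableOn_flowJ hx₀.1.le hβ0 hβ hd0 hd 0).inv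
      fun z hz => flowJ_zero_ne_zero hx₀.1.le hβ0 hβ hd0 hd hz).mul
      (h1.sub ((h1.pow 2).const_mul _))
  · filter_upwards [hev] with x ⟨hx, hx1, e1, e2⟩
    have h0 := flowJ_zero_ne_zero hx₀.1.le hβ0 hβ hd0 hd hx1
    rw [e2] at h0 ⊢
    rw [e1, inv_mul_eq_iff_eq_mul₀ h0]
    exact_mod_cast (hh.four_eq hx (hode x hx)).symm
  · intro z hz
    have hz1 := hsub hz
    have hJ := norm_inv_flowJ_zero_le hx₀.1.le hβ0 hβ hd0 hd hz1
    have hΔz := norm_complexCoupling_le hβ0 hβ hd0 hd hz1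
    rw [← hΔ] at hΔz
    have h2 : ‖Δ z - β * Δ z ^ 2‖ ≤ 11 / 10 * d := by
      refine (norm_sub_le _ _).trans ?_
      rw [norm_mul, norm_pow]
      have h3 : ‖Δ z‖ ^ 2 ≤ (100 / 99 * d) ^ 2 := pow_le_pow_left₀ (norm_nonneg _) hΔz 2
      have h4 := mul_le_mul hβn h3 (by positivity) (by norm_num)
      nlinarith
    rw [norm_mul, hfac]
    refine (mul_le_mul hJ h2 (norm_nonneg _) (by positivity)).trans ?_
    have e : 4 * mfc * d * (1 / (2 * mfc ^ 2)) = 2 * (d / mfc) := by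
      field_simp
      norm_num
    have e' : 11 / 10 / mfc * (11 / 10 * d) = 121 / 100 * (d / mfc) := by ring
    rw [e, e']
    have : 0 < d / mfc := by positivity
    linarith
  · intro z hz
    have hz1 := hsub hz
    have hJ := norm_inv_flowJ_zero_le hx₀.1.le hβ0 hβ hd0 hd hz1
    have hJ0 := norm_flowJ_zero_sub_le hx₀.1.le hβ0 hβ hd0 hd hz1
    have h0 := flowJ_zero_ne_zero hx₀.1.le hβ0 hβ hd0 hd hz1
    have hΔz := norm_complexCoupling_le hβ0 hβ hd0 hd hz1
    have hΔs := norm_complexCoupling_sub_le hβ0 hβ hd0 hd hz1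
    rw [← hΔ] at hΔz hΔs
    have hcC : (mfc : ℂ) ≠ 0 := Complex.ofReal_ne_zero.2 hc.ne'
    have e : (flowJ β d x₀ 0 z)⁻¹ * (Δ z - β * Δ z ^ 2) - ((d / mfc : ℝ) : ℂ) =
        (flowJ β d x₀ 0 z)⁻¹ * ((Δ z - d) - β * Δ z ^ 2
          - (d / mfc : ℝ) * (flowJ β d x₀ 0 z - mfc)) := by
      push_cast
      field_simp
      ring
    have h2 : ‖(Δ z - d) - β * Δ z ^ 2 - (d / mfc : ℝ) * (flowJ β d x₀ 0 z - mfc)‖ ≤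
        20 * d ^ 2 := by
      refine (norm_sub_le _ _).trans ?_
      have h1 := norm_sub_le (Δ z - d) (β * Δ z ^ 2)
      rw [norm_mul, norm_pow] at h1
      have h3 : ‖Δ z‖ ^ 2 ≤ (100 / 99 * d) ^ 2 := pow_le_pow_left₀ (norm_nonneg _) hΔz 2
      have h4 := mul_le_mul hβn h3 (by positivity) (by norm_num)
      have h5 : ‖((d / mfc : ℝ) : ℂ) * (flowJ β d x₀ 0 z - mfc)‖ ≤ 1000 / 99 * d ^ 2 := by
        rw [norm_mul, Complex.norm_real, Real.norm_eq_abs, abs_of_pos (by positivity)]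
        refine (mul_le_mul_of_nonneg_left hJ0 (by positivity)).trans (le_of_eq ?_)
        field_simp
      nlinarith
    rw [e, norm_mul, hfac]
    refine (mul_le_mul hJ h2 (norm_nonneg _) (by positivity)).trans ?_
    have e1 : 16 * d ^ 2 * (1 / (2 * mfc ^ 2)) = 8 * (d ^ 2 / mfc) * (1 / mfc) := by
      field_simp
      norm_num
    have e2 : 11 / 10 / mfc * (20 * d ^ 2) = 22 * (d ^ 2 / mfc) := by ring
    rw [e1, e2]
    have h6 : 144 ≤ 1 / mfc := by
      rw [le_div_iff₀ hc]
      linarith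
    have : 0 < d ^ 2 / mfc := by positivity
    nlinarith

theorem growthExtension_step {a : ℕ} (ha : Even a) (ha2 : 2 ≤ a) {H : ℕ → ℂ → ℂ} {κ : ℕ → ℝ}
    (hH : ∀ b < a + 2, Even b → 2 ≤ b → GrowthExtension x₀ (δ x₀) b (h (b + 2)) (H b) (κ b)) :
    ∃ F, GrowthExtension x₀ (δ x₀) (a + 2) (h (a + 2 + 2)) F 0 := by
  have hx₀' := Set.Ioo_subset_Icc_self hx₀
  have hd0 := hpos x₀ hx₀'
  have hd := hle x₀ hx₀'
  have hc := mfc_pos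
  have hc2 := mfc_lt
  have hev := eventually_coupling_eq (β := β) hδ hode hpos hx₀
  set d := δ x₀ with hd_def
  set n := a + 2 with hn_def
  have hn : Even n := ha.add even_two
  have hHa := hH a (by omega) ha ha2
  have hnR : (n : ℝ) = a + 2 := by simp [hn_def]
  have haR : (2 : ℝ) ≤ a := by exact_mod_cast ha2
  set F : ℂ → ℂ := fun z => (flowJ β d x₀ 0 z)⁻¹ *
    (treeSum n (fun v => flowJ β d x₀ v z) (fun b => H b z)
      + ((2 / ((n : ℝ) * ((n : ℝ) - 1)) : ℝ) : ℂ) * deriv (H a) z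
      + ((((n : ℝ) - 4) / ((n : ℝ) * ((n : ℝ) - 1)) : ℝ) : ℂ) * H a z) with hF
  have hbound : ∀ z ∈ Metric.ball (x₀ : ℂ) (1 / 2 + 1 / (n : ℝ)),
      ‖F z‖ ≤ 16 * d ^ 2 * ((2 * mfc)⁻¹ ^ n * n.factorial) := by
    intro z hz
    have hz1 := ball_half_add_inv_subset (x₀ : ℂ) (show 2 ≤ n by omega) hz
    have hsubb : ∀ b < n, Even b → 2 ≤ b → z ∈ Metric.ball (x₀ : ℂ) (1 / 2 + 1 / (b : ℝ)) := by
      intro b hb _ hb2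
      refine Metric.ball_subset_ball ?_ hz
      have h1 : (b : ℝ) ≤ n := by exact_mod_cast hb.le
      have h2 : (0 : ℝ) < b := by exact_mod_cast (by omega : 0 < b)
      linarith [one_div_le_one_div_of_le h2 h1]
    have hJ := norm_inv_flowJ_zero_le hx₀.1.le hβ0 hβ hd0 hd hz1
    have htree := norm_treeSum_le (n := n) (J := fun v => flowJ β d x₀ v z)
      (H := fun b => H b z) hd0 hd (fun v => norm_flowJ_le hx₀.1.le hβ0 hβ hd0 hd hz1 v)
      (fun b hb hb1 hb2 => (hH b hb hb1 hb2).norm_le z (hsubb b hb hb1 hb2))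
    have hder := hHa.norm_deriv_le ha2 hz
    set G : ℝ := (2 * mfc)⁻¹ ^ n * n.factorial with hG
    set A : ℝ := (2 * mfc)⁻¹ ^ a * a.factorial with hA
    have hG0 : 0 < G := by positivity
    have hA0 : 0 < A := by positivity
    have hGA : G * (4 * mfc ^ 2) = A * ((a + 2) * (a + 1)) := by
      rw [hG, hA, hn_def, Nat.factorial_succ, Nat.factorial_succ, pow_add]
      push_cast
      field_simp
      ring
    have hAG : A * 12 ≤ G * (4 * mfc ^ 2) := by
      rw [hGA]
      exact mul_le_mul_of_nonneg_left (by nlinarith) hA0.le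
    have hlin1 : ‖((2 / ((n : ℝ) * ((n : ℝ) - 1)) : ℝ) : ℂ) * deriv (H a) z‖ ≤
        16 * d ^ 2 * A := by
      have hp : 0 < 2 / ((n : ℝ) * ((n : ℝ) - 1)) := by
        rw [hnR]
        exact div_pos two_pos (mul_pos (by linarith) (by linarith))
      rw [norm_mul, Complex.norm_real, Real.norm_eq_abs, abs_of_pos hp]
      refine (mul_le_mul_of_nonneg_left hder hp.le).trans ?_
      have h1 : (a : ℝ) + 2 - 1 ≠ 0 := by linarith
      have e : 2 / ((n : ℝ) * ((n : ℝ) - 1)) * (16 * d ^ 2 * A * (a * (a + 2) / 2)) =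
          16 * d ^ 2 * A * (a / (a + 2 - 1)) := by
        rw [hnR]
        field_simp
      rw [e]
      refine mul_le_of_le_one_right (by positivity) ?_
      rw [div_le_one (by linarith)]
      linarith
    have hlin2 : ‖((((n : ℝ) - 4) / ((n : ℝ) * ((n : ℝ) - 1)) : ℝ) : ℂ) * H a z‖ ≤
        16 * d ^ 2 * A := by
      rcases eq_or_ne a 2 with h2 | h2
      · have : (n : ℝ) - 4 = 0 := by
          rw [hnR, h2]
          norm_num
        rw [this, zero_div, Complex.ofReal_zero, zero_mul, norm_zero]
        positivity
      · have h3 := hHa.norm_sub_le z (hsubb a (by omega) ha ha2)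
        rw [hHa.eq_zero h2, Complex.ofReal_zero, sub_zero] at h3
        have ha4 : (4 : ℝ) ≤ a := by
          obtain ⟨k, hk⟩ := ha
          exact_mod_cast (by omega : 4 ≤ a)
        have hp : 0 ≤ ((n : ℝ) - 4) / ((n : ℝ) * ((n : ℝ) - 1)) ∧
            ((n : ℝ) - 4) / ((n : ℝ) * ((n : ℝ) - 1)) ≤ 1 := by
          rw [hnR]
          have h5 : 0 < ((a : ℝ) + 2) * (a + 2 - 1) := mul_pos (by linarith) (by linarith)
          exact ⟨div_nonneg (by linarith) h5.le, (div_le_one h5).2 (by nlinarith)⟩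
        rw [norm_mul, Complex.norm_real, Real.norm_eq_abs, abs_of_nonneg hp.1]
        exact (mul_le_of_le_one_left (norm_nonneg _) hp.2).trans h3
    have hsum := (norm_add₃_le (a := treeSum n (fun v => flowJ β d x₀ v z) (fun b => H b z))
      (b := ((2 / ((n : ℝ) * ((n : ℝ) - 1)) : ℝ) : ℂ) * deriv (H a) z)
      (c := ((((n : ℝ) - 4) / ((n : ℝ) * ((n : ℝ) - 1)) : ℝ) : ℂ) * H a z)).trans
      (add_le_add (add_le_add htree hlin1) hlin2)
    rw [hF, norm_mul]
    refine (mul_le_mul hJ hsum (norm_nonneg _) (by positivity)).trans ?_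
    have h7 : mfc * d ^ 2 * G + 16 * d ^ 2 * A + 16 * d ^ 2 * A ≤ 2 * (mfc * (d ^ 2 * G)) := by
      have h8 : 32 * A ≤ mfc * G := by
        have : mfc * (mfc * G) ≤ 1 / 144 * (mfc * G) :=
          mul_le_mul_of_nonneg_right hc2.le (by positivity)
        nlinarith
      nlinarith [mul_le_mul_of_nonneg_left h8 (sq_nonneg d)]
    refine (mul_le_mul_of_nonneg_left h7 (by positivity)).trans ?_
    have e : 11 / 10 / mfc * (2 * (mfc * (d ^ 2 * G))) = 11 / 5 * (d ^ 2 * G) := by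
      field_simp
      norm_num
    rw [e]
    have : 0 ≤ d ^ 2 * G := by positivity
    linarith
  refine ⟨F, ?_, ?_, ?_, ?_, fun _ => rfl⟩
  · exact ((differentiableOn_flowJ hx₀.1.le hβ0 hβ hd0 hd 0).inv
      fun z hz => flowJ_zero_ne_zero hx₀.1.le hβ0 hβ hd0 hd hz).mul
      (((differentiableOn_treeSum (fun v => differentiableOn_flowJ hx₀.1.le hβ0 hβ hd0 hd v)
        (fun b hb hb1 hb2 => (hH b hb hb1 hb2).diff)).add
        ((hHa.diff.deriv Metric.isOpen_ball).const_mul _)).add (hHa.diff.const_mul _))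
  · have hall : ∀ᶠ x : ℝ in nhds x₀, ∀ b ∈ Finset.range n, Even b → 2 ≤ b →
        H b x = h (b + 2) x := by
      refine (Filter.eventually_all_finset _).2 fun b hb => ?_
      by_cases hb' : Even b ∧ 2 ≤ b
      · filter_upwards [(hH b (Finset.mem_range.1 hb) hb'.1 hb'.2).agree] with x hx _ _ using hx
      · exact Filter.Eventually.of_forall fun x h1 h2 => absurd ⟨h1, h2⟩ hb'
    filter_upwards [hev, hall, hHa.agree,
      eventually_deriv_eq_ofReal_deriv one_pos hHa.diff hHa.agree] with x ⟨hx, hx1, _, e2⟩ h1 h2 h3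
    have h0 := flowJ_zero_ne_zero hx₀.1.le hβ0 hβ hd0 hd hx1
    have htree : treeSum n (fun v => flowJ β d x₀ v x) (fun b => H b x) =
        ((treeSum n (fun v => Jflow δ v x) (fun b => h (b + 2) x) : ℝ) : ℂ) := by
      rw [ofReal_treeSum]
      exact treeSum_congr e2 fun b hb => h1 b (Finset.mem_range.2 hb)
    have heq := hh.eq_treeSum hn (by omega) hx
    simp only [hF]
    rw [inv_mul_eq_iff_eq_mul₀ h0, htree, h2, h3, e2]
    exact_mod_cast heq.symm
  · intro z hz
    refine (hbound z hz).trans (mul_le_mul_of_nonneg_right ?_ (by positivity))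
    nlinarith
  · intro z hz
    rw [Complex.ofReal_zero, sub_zero]
    exact hbound z hz

theorem exists_growthExtension (b : ℕ) (hb : Even b) (hb2 : 2 ≤ b) :
    ∃ H κ, GrowthExtension x₀ (δ x₀) b (h (b + 2)) H κ := by
  induction b using Nat.strong_induction_on with
  | _ b ih =>
    rcases eq_or_ne b 2 with rfl | hne
    · obtain ⟨H, hH⟩ := growthExtension_four hβ0 hβ hδ hode hpos hle hh hx₀
      exact ⟨H, _, hH⟩
    · choose! H κ hH using ih
      obtain ⟨a, rfl⟩ : ∃ a, b = a + 2 := ⟨b - 2, by omega⟩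
      have ha : Even a := by simpa [Nat.even_add] using hb
      have ha2 : 2 ≤ a := by
        obtain ⟨k, hk⟩ := ha
        omega
      obtain ⟨F, hF⟩ := growthExtension_step hβ0 hβ hδ hode hpos hle hh hx₀ ha ha2 hH
      exact ⟨F, 0, hF⟩

/-- Derivative bounds at an interior point of the flow interval. -/
theorem abs_iteratedDeriv_le_of_mem_Ioo {b : ℕ} (hb : Even b) (hb2 : 2 ≤ b) {l : ℕ}
    (hbl : b = 2 → 1 ≤ l) :
    |iteratedDeriv l (h (b + 2)) x₀| ≤
      l.factorial * (16 * δ x₀ ^ 2 * ((2 * mfc)⁻¹ ^ b * b.factorial)) * 2 ^ l := by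
  obtain ⟨H, κ, hH⟩ := exists_growthExtension hβ0 hβ hδ hode hpos hle hh hx₀ b hb hb2
  have hb0 : (0 : ℝ) < b := by exact_mod_cast (by omega : 0 < b)
  have hcl : Metric.closedBall (x₀ : ℂ) (1 / 2) ⊆ Metric.ball (x₀ : ℂ) (1 / 2 + 1 / (b : ℝ)) :=
    Metric.closedBall_subset_ball (by linarith [one_div_pos.2 hb0])
  have key := abs_iteratedDeriv_le_of_holomorphic_extension (F := fun z => H z - κ)
    (f := fun x => h (b + 2) x - κ) (x₀ := x₀) (s := 1 / 2) (by norm_num)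
    (show (1 / 2 : ℝ) < 1 by norm_num) (hH.diff.sub_const _)
    (by filter_upwards [hH.agree] with x hx using by rw [hx, Complex.ofReal_sub])
    (fun z hz => hH.norm_sub_le z (hcl hz)) l
  have e : iteratedDeriv l (fun x => h (b + 2) x - κ) = iteratedDeriv l (h (b + 2)) := by
    rcases Nat.eq_zero_or_pos l with rfl | hl
    · have : κ = 0 := hH.eq_zero fun hb => absurd (hbl hb) (by norm_num)
      simp [this]
    · obtain ⟨k, rfl⟩ : ∃ k, l = k + 1 := ⟨l - 1, by omega⟩
      rw [iteratedDeriv_succ', iteratedDeriv_succ']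
      congr 1
      funext x
      exact deriv_sub_const _
  rw [e] at key
  refine key.trans (le_of_eq ?_)
  rw [div_pow, one_pow, div_div_eq_mul_div, div_one]

end Extension

theorem pow_two_mul_le {K : ℝ} (hK : 6 ≤ K) (l : ℕ) :
    2 ^ l * (((l : ℝ) + 2) * (l + 1)) ≤ 2 * K ^ l := by
  induction l with
  | zero => norm_num
  | succ l ih =>
    have hl : (0 : ℝ) ≤ l := l.cast_nonneg
    push_cast
    calc (2 : ℝ) ^ (l + 1) * (((l : ℝ) + 1 + 2) * (l + 1 + 1))
        = 2 ^ l * (((l : ℝ) + 2) * (2 * (l + 3))) := by ring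
      _ ≤ 2 ^ l * (((l : ℝ) + 2) * (6 * (l + 1))) := by
        gcongr 2 ^ l * (((l : ℝ) + 2) * ?_)
        linarith
      _ = 6 * (2 ^ l * (((l : ℝ) + 2) * (l + 1))) := by ring
      _ ≤ K * (2 * K ^ l) := by gcongr
      _ = 2 * K ^ (l + 1) := by ring

theorem quadratic_le_eight_pow {b : ℕ} (hb : 4 ≤ b) :
    32 * (((b : ℝ) + 4) * (b + 3)) ≤ 8 ^ b := by
  induction b, hb using Nat.le_induction with
  | base => norm_num
  | succ b hb ih =>
    have hb' : (4 : ℝ) ≤ b := by exact_mod_cast hb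
    rw [pow_succ]
    push_cast
    nlinarith

theorem bound_le_of_six_le {c d K : ℝ} (hc : 0 < c) (hc2 : c < 1 / 144) (hK : 4 / c ≤ K)
    {b : ℕ} (hb : 4 ≤ b) (l : ℕ) :
    l.factorial * (16 * d ^ 2 * ((2 * c)⁻¹ ^ b * b.factorial)) * 2 ^ l ≤
      d ^ 2 * K ^ (b + l) * ((b + l).factorial : ℝ) /
        (((b : ℝ) + 4) * (b + 3) * ((l : ℝ) + 2) * (l + 1)) := by
  have hK6 : 6 ≤ K := by
    refine le_trans ?_ hK
    rw [le_div_iff₀ hc]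
    linarith
  have hf : (b.factorial : ℝ) * l.factorial ≤ (b + l).factorial := by
    exact_mod_cast Nat.le_of_dvd (Nat.factorial_pos _)
      (Nat.factorial_mul_factorial_dvd_factorial_add b l)
  have hKb : 8 ^ b * (2 * c)⁻¹ ^ b ≤ K ^ b := by
    rw [← mul_pow]
    refine pow_le_pow_left₀ (by positivity) (le_trans (le_of_eq ?_) hK) b
    field_simp
    norm_num
  have h1 := pow_two_mul_le hK6 l
  have h2 := quadratic_le_eight_pow hb
  rw [le_div_iff₀ (by positivity)]
  calc _ = d ^ 2 * (16 * (((b : ℝ) + 4) * (b + 3)) * (2 * c)⁻¹ ^ b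
          * (2 ^ l * (((l : ℝ) + 2) * (l + 1)))) * (b.factorial * l.factorial) := by ring
    _ ≤ d ^ 2 * (16 * (((b : ℝ) + 4) * (b + 3)) * (2 * c)⁻¹ ^ b * (2 * K ^ l))
          * (b + l).factorial := by gcongr
    _ = d ^ 2 * (32 * (((b : ℝ) + 4) * (b + 3)) * (2 * c)⁻¹ ^ b * K ^ l)
          * (b + l).factorial := by ring
    _ ≤ d ^ 2 * (8 ^ b * (2 * c)⁻¹ ^ b * K ^ l) * (b + l).factorial := by gcongr
    _ ≤ d ^ 2 * (K ^ b * K ^ l) * (b + l).factorial := by gcongr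
    _ = _ := by ring

theorem bound_le_of_four {c d K : ℝ} (hc : 0 < c) (hc2 : c < 1 / 144) (hK : 4 / c ≤ K)
    {l : ℕ} (hl : 1 ≤ l) :
    l.factorial * (16 * d ^ 2 * ((2 * c)⁻¹ ^ 2 * (Nat.factorial 2 : ℝ))) * 2 ^ l ≤
      d ^ 2 * K ^ (2 + l) * ((2 + l).factorial : ℝ) /
        ((4 + 2 : ℝ) * (4 + 1) * ((l : ℝ) + 2) * (l + 1)) := by
  have hc0 : 0 < 4 / c := by positivity
  have hK30 : 30 ≤ K := by
    refine le_trans ?_ hK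
    rw [le_div_iff₀ hc]
    linarith
  have hK2 : (4 / c) ^ 2 ≤ K ^ 2 := pow_le_pow_left₀ hc0.le hK 2
  have hKl : 15 * 2 ^ l ≤ K ^ l := by
    obtain ⟨k, rfl⟩ : ∃ k, l = k + 1 := ⟨l - 1, by omega⟩
    have : (2 : ℝ) ^ k ≤ K ^ k := pow_le_pow_left₀ (by norm_num) (by linarith) k
    rw [pow_succ, pow_succ]
    nlinarith [pow_pos (show (0 : ℝ) < 2 by norm_num) k]
  have hf : ((2 + l).factorial : ℝ) = (l + 2) * (l + 1) * l.factorial := by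
    rw [add_comm 2 l, Nat.factorial_succ, Nat.factorial_succ]
    push_cast
    ring
  rw [le_div_iff₀ (by positivity), hf]
  calc _ = d ^ 2 * ((4 / c) ^ 2 * (15 * 2 ^ l)) * ((l + 2) * (l + 1) * l.factorial) := by
        norm_num [Nat.factorial]
        field_simp
        ring
    _ ≤ d ^ 2 * (K ^ 2 * K ^ l) * ((l + 2) * (l + 1) * l.factorial) := by gcongr
    _ = _ := by ring

/-- A pointwise inequality between continuous functions on the open interval extends to the
closed one. -/
theorem le_on_Icc_of_le_on_Ioo {T : ℝ} (hT : 0 < T) {f g : ℝ → ℝ} (hf : Continuous f)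
    (hg : Continuous g) (hfg : ∀ x ∈ Set.Ioo 0 T, f x ≤ g x) :
    ∀ x ∈ Set.Icc 0 T, f x ≤ g x := by
  intro x hx
  rw [← closure_Ioo hT.ne] at hx
  exact le_on_closure hfg hf.continuousOn hg.continuousOn hx

/-- positivity of the 1PI four-point function and bounds
`|∂_μ^l h_n(μ)| ≤ 𝓑(n,l;μ)` for the 1PI mean field hierarchy with `h₂ = −δ`. -/
theorem stmt15 (μmax β δbar : ℝ) (hμmax : 0 < μmax) (hβ0 : 0 < β) (hβ : β ≤ 2)
    (hδbar0 : 0 < δbar) (hδbar : δbar ≤ mfc / 4)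
    (δ : ℝ → ℝ) (hδsmooth : ContDiff ℝ (⊤ : ℕ∞) δ)
    (hδode : ∀ μ ∈ Set.Icc (0 : ℝ) μmax, deriv δ μ = β * δ μ ^ 2)
    (hδrange : ∀ μ ∈ Set.Icc (0 : ℝ) μmax, 0 < δ μ ∧ δ μ ≤ δbar)
    (h : ℕ → ℝ → ℝ) (hh : OnePIHierarchy μmax δ h) :
    -- (i)
    (∀ μ ∈ Set.Icc (0 : ℝ) μmax,
      h 4 μ = (Jflow δ 0 μ)⁻¹ * (δ μ - β * δ μ ^ 2) ∧
      (1 - δ μ) ^ 2 * (δ μ - β * δ μ ^ 2) / mfc < h 4 μ ∧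
      0 < (1 - δ μ) ^ 2 * (δ μ - β * δ μ ^ 2) / mfc) ∧
    -- (ii)
    (∀ K : ℝ, 4 / mfc ≤ K →
      (∀ n l : ℕ, Even n → 6 ≤ n → ∀ μ ∈ Set.Icc (0 : ℝ) μmax,
        |iteratedDeriv l (h n) μ| ≤
          δ μ ^ 2 * K ^ (n + l - 2) * ((n + l - 2).factorial : ℝ) /
            (((n : ℝ) + 2) * ((n : ℝ) + 1) * ((l : ℝ) + 2) * ((l : ℝ) + 1))) ∧
      (∀ l : ℕ, 1 ≤ l → ∀ μ ∈ Set.Icc (0 : ℝ) μmax,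
        |iteratedDeriv l (h 4) μ| ≤
          δ μ ^ 2 * K ^ (4 + l - 2) * ((4 + l - 2).factorial : ℝ) /
            ((4 + 2 : ℝ) * (4 + 1) * ((l : ℝ) + 2) * ((l : ℝ) + 1))) ∧
      (∀ μ ∈ Set.Icc (0 : ℝ) μmax,
        |h 4 μ| ≤
          (δ μ ^ 2 * K ^ (4 + 0 - 2) * (((4 + 0 - 2 : ℕ)).factorial : ℝ) /
            ((4 + 2 : ℝ) * (4 + 1) * ((0 : ℝ) + 2) * ((0 : ℝ) + 1))) * (4 * mfc / δ μ))) := by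
  have hc := mfc_pos
  have hc2 := mfc_lt
  have hpos : ∀ x ∈ Set.Icc (0 : ℝ) μmax, 0 < δ x := fun x hx => (hδrange x hx).1
  have hle : ∀ x ∈ Set.Icc (0 : ℝ) μmax, δ x ≤ mfc / 4 :=
    fun x hx => (hδrange x hx).2.trans hδbar
  have hδd : Differentiable ℝ δ := hδsmooth.differentiable (by simp)
  have hfour : ∀ μ ∈ Set.Icc (0 : ℝ) μmax,
      h 4 μ = (Jflow δ 0 μ)⁻¹ * (δ μ - β * δ μ ^ 2) ∧ 0 < δ μ - β * δ μ ^ 2 ∧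
        mfc ≤ Jflow δ 0 μ ∧ Jflow δ 0 μ < mfc / (1 - δ μ) ^ 2 := by
    intro μ hμ
    have h0 := hpos μ hμ
    have h1 := hle μ hμ
    have hJ := Jflow_zero_bounds hμ.1 h0 (by linarith : δ μ < 1)
    refine ⟨?_, ?_, hJ⟩
    · rw [eq_inv_mul_iff_mul_eq₀ (by linarith [hJ.1])]
      exact hh.four_eq hμ (hδode μ hμ)
    · nlinarith [mul_le_mul_of_nonneg_right hβ (sq_nonneg (δ μ))]
  have hcont : ∀ n l : ℕ, Continuous fun μ => |iteratedDeriv l (h n) μ| := fun n l =>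
    ((hh.1 n).continuous_iteratedDeriv l (by exact_mod_cast le_top)).abs
  have hδc : Continuous δ := hδd.continuous
  refine ⟨fun μ hμ => ?_, fun K hK => ⟨fun n l hn hn6 => ?_, fun l hl => ?_, fun μ hμ => ?_⟩⟩
  · obtain ⟨e, hp, hJ1, hJ2⟩ := hfour μ hμ
    have h1 : 0 < 1 - δ μ := by linarith [hle μ hμ]
    refine ⟨e, ?_, by positivity⟩
    rw [e, inv_mul_eq_div, div_lt_div_iff₀ hc (by linarith)]
    rw [lt_div_iff₀ (by positivity)] at hJ2
    nlinarith [mul_lt_mul_of_pos_left hJ2 hp]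
  · obtain ⟨b, rfl⟩ : ∃ b, n = b + 2 := ⟨n - 2, by omega⟩
    have hb : Even b := by simpa [Nat.even_add] using hn
    refine le_on_Icc_of_le_on_Ioo hμmax (hcont _ l) (by fun_prop) fun x hx => ?_
    refine (abs_iteratedDeriv_le_of_mem_Ioo hβ0 hβ hδd hδode hpos hle hh hx hb (by omega)
      (by omega)).trans ((bound_le_of_six_le hc hc2 hK (by omega) l).trans (le_of_eq ?_))
    rw [show b + 2 + l - 2 = b + l by omega]
    push_cast
    ring
  · refine le_on_Icc_of_le_on_Ioo hμmax (hcont _ l) (by fun_prop) fun x hx => ?_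
    refine (abs_iteratedDeriv_le_of_mem_Ioo hβ0 hβ hδd hδode hpos hle hh hx even_two le_rfl
      fun _ => hl).trans ((bound_le_of_four hc hc2 hK hl).trans (le_of_eq ?_))
    rw [show 4 + l - 2 = 2 + l by omega]
  · obtain ⟨e, hp, hJ1, -⟩ := hfour μ hμ
    have h0 := hpos μ hμ
    have hK2 : (4 / mfc) ^ 2 ≤ K ^ 2 := pow_le_pow_left₀ (by positivity) hK 2
    rw [e, abs_of_pos (mul_pos (inv_pos.2 (by linarith)) hp)]
    calc (Jflow δ 0 μ)⁻¹ * (δ μ - β * δ μ ^ 2) ≤ mfc⁻¹ * δ μ := by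
          gcongr
          nlinarith [mul_pos hβ0 (pow_pos h0 2)]
      _ ≤ 2 / 15 * δ μ * mfc * (4 / mfc) ^ 2 := by
          have : 0 < mfc⁻¹ * δ μ := by positivity
          have e2 : 2 / 15 * δ μ * mfc * (4 / mfc) ^ 2 = 32 / 15 * (mfc⁻¹ * δ μ) := by
            field_simp
            norm_num
          rw [e2]
          linarith
      _ ≤ 2 / 15 * δ μ * mfc * K ^ 2 := by gcongr
      _ = _ := by
          norm_num [Nat.factorial]
          field_simp
          ring
end

section
/- Let 0 < ε and let (a_n)_{n ≥ 1} be a real sequence with |a_n| ≤ 4·(3/4)^{n}·ε for all n ≥ 1. Then the series f₂(μ) := Σ_{n ≥ 1} a_n·(nμ)^{n−1}/(1 + (nμ)^{n}) converges absolutely and uniformly on [0, ∞) together with all its term-by-term derivatives, defines a smooth function on [0, ∞), and satisfies lim_{μ → ∞} f₂^{(l)}(μ) = 0 for every integer l ≥ 0. -/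
/-- The `n`-th summand `a_{n+1}·((n+1)μ)^n/(1 + ((n+1)μ)^{n+1})` of the series `f₂`. -/
noncomputable def f2term (a : ℕ → ℝ) (n : ℕ) (μ : ℝ) : ℝ :=
  a (n + 1) * (((n : ℝ) + 1) * μ) ^ n / (1 + (((n : ℝ) + 1) * μ) ^ (n + 1))

/-- The series `f₂(μ) = Σ_{n ≥ 1} a_n·(nμ)^{n−1}/(1 + (nμ)^n)`. -/
noncomputable def f2series (a : ℕ → ℝ) (μ : ℝ) : ℝ :=
  ∑' n : ℕ, f2term a n μ

open Set Filter Topology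

/-- The rational function `(cμ)^j / (1 + (cμ)^(n+1))^(k+1)`; the span of this family is closed
under differentiation in `μ`. -/
noncomputable def powQuot (c : ℝ) (n j k : ℕ) (μ : ℝ) : ℝ :=
  (c * μ) ^ j / (1 + (c * μ) ^ (n + 1)) ^ (k + 1)

section PowQuot

variable {c : ℝ} {n : ℕ}

theorem contDiffOn_powQuot (hc : 0 < c) (j k : ℕ) {m : ℕ∞} :
    ContDiffOn ℝ m (powQuot c n j k) (Ici 0) := by
  unfold powQuot
  refine ContDiffOn.div (by fun_prop) (by fun_prop) fun μ hμ => ?_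
  have hμ : 0 ≤ μ := hμ
  positivity

theorem hasDerivWithinAt_powQuot (hc : 0 < c) (j k : ℕ) {μ : ℝ} (hμ : 0 ≤ μ) :
    HasDerivWithinAt (powQuot c n j k)
      (c * j * powQuot c n (j - 1) k μ -
        c * (k + 1) * (n + 1) * powQuot c n (j + n) (k + 1) μ) (Ici 0) μ := by
  have hx : HasDerivAt (fun μ : ℝ => c * μ) c μ := by
    simpa using (hasDerivAt_id μ).const_mul c
  have hD : (1 + (c * μ) ^ (n + 1)) ≠ 0 := by positivity
  have h := (hx.pow j).div (((hx.pow (n + 1)).const_add 1).pow (k + 1)) (pow_ne_zero _ hD)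
  refine (h.congr_deriv ?_).hasDerivWithinAt
  simp only [powQuot, Pi.pow_apply, Nat.add_sub_cancel]
  push_cast
  field_simp
  ring

theorem powQuot_nonneg (hc : 0 < c) (j k : ℕ) {μ : ℝ} (hμ : 0 ≤ μ) : 0 ≤ powQuot c n j k μ := by
  unfold powQuot
  positivity

theorem powQuot_le_one (hc : 0 < c) {j k : ℕ} (hjk : j ≤ (n + 1) * (k + 1)) {μ : ℝ}
    (hμ : 0 ≤ μ) : powQuot c n j k μ ≤ 1 := by
  have hx : 0 ≤ c * μ := by positivity
  refine div_le_one_of_le₀ ?_ (by positivity)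
  rcases le_total (c * μ) 1 with h | h
  · exact (pow_le_one₀ hx h).trans (one_le_pow₀ (by linarith [pow_nonneg hx (n + 1)]))
  · calc (c * μ) ^ j ≤ (c * μ) ^ ((n + 1) * (k + 1)) := pow_le_pow_right₀ h hjk
      _ = ((c * μ) ^ (n + 1)) ^ (k + 1) := pow_mul _ _ _
      _ ≤ (1 + (c * μ) ^ (n + 1)) ^ (k + 1) := by gcongr; linarith

theorem tendsto_powQuot_atTop (hc : 0 < c) {j k : ℕ} (hjk : j < (n + 1) * (k + 1)) :
    Tendsto (powQuot c n j k) atTop (𝓝 0) := by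
  have hinv : Tendsto (fun μ : ℝ => (c * μ)⁻¹) atTop (𝓝 0) :=
    tendsto_inv_atTop_zero.comp (tendsto_id.const_mul_atTop hc)
  refine tendsto_of_tendsto_of_tendsto_of_le_of_le' tendsto_const_nhds hinv ?_ ?_
  · filter_upwards [eventually_ge_atTop 0] with μ hμ using powQuot_nonneg hc j k hμ
  · filter_upwards [eventually_gt_atTop 0] with μ hμ
    have h := powQuot_le_one hc (Nat.succ_le_of_lt hjk) hμ.le
    have hx : 0 < c * μ := by positivity
    rw [← one_div, le_div_iff₀ hx]
    refine le_of_eq_of_le ?_ h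
    simp only [powQuot, Nat.succ_eq_add_one, pow_succ _ j]
    ring

theorem iteratedDerivWithin_succ_powQuot (hc : 0 < c) (l j k : ℕ) {μ : ℝ} (hμ : 0 ≤ μ) :
    iteratedDerivWithin (l + 1) (powQuot c n j k) (Ici 0) μ =
      c * j * iteratedDerivWithin l (powQuot c n (j - 1) k) (Ici 0) μ -
        c * (k + 1) * (n + 1) *
          iteratedDerivWithin l (powQuot c n (j + n) (k + 1)) (Ici 0) μ := by
  have hu := uniqueDiffOn_Ici (0 : ℝ)
  have hder : EqOn (derivWithin (powQuot c n j k) (Ici 0))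
      ((fun μ => c * j * powQuot c n (j - 1) k μ) -
        fun μ => c * (k + 1) * (n + 1) * powQuot c n (j + n) (k + 1) μ) (Ici 0) :=
    fun x hx => (hasDerivWithinAt_powQuot hc j k hx).derivWithin (hu x hx)
  have hsmooth (b : ℝ) (i m : ℕ) :
      ContDiffWithinAt ℝ l (fun μ => b * powQuot c n i m μ) (Ici 0) μ :=
    contDiffWithinAt_const.mul (contDiffOn_powQuot hc i m (m := l) μ hμ)
  rw [iteratedDerivWithin_succ', iteratedDerivWithin_congr hder hμ,
    iteratedDerivWithin_sub (mem_Ici.2 hμ) hu (hsmooth _ _ _) (hsmooth _ _ _),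
    iteratedDerivWithin_const_mul_field, iteratedDerivWithin_const_mul_field]

theorem abs_iteratedDerivWithin_powQuot_le (hc : 0 < c) (l : ℕ) {j k : ℕ}
    (hjk : j ≤ (n + 1) * (k + 1)) {μ : ℝ} (hμ : 0 ≤ μ) :
    |iteratedDerivWithin l (powQuot c n j k) (Ici 0) μ| ≤
      (2 * c * (n + 1) * (k + l + 1)) ^ l := by
  induction l generalizing j k with
  | zero =>
    simpa [abs_of_nonneg (powQuot_nonneg hc j k hμ)] using powQuot_le_one hc hjk hμ
  | succ l ih =>
    rw [iteratedDerivWithin_succ_powQuot hc l j k hμ]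
    set B : ℝ := 2 * c * (n + 1) * (k + (l + 1 : ℕ) + 1) with hB
    have h₁ : |iteratedDerivWithin l (powQuot c n (j - 1) k) (Ici 0) μ| ≤ B ^ l := by
      refine (ih (by omega)).trans ?_
      rw [hB]
      gcongr
      linarith
    have h₂ : |iteratedDerivWithin l (powQuot c n (j + n) (k + 1)) (Ici 0) μ| ≤ B ^ l := by
      refine (ih (by nlinarith)).trans_eq ?_
      rw [hB]
      push_cast
      ring
    have hj : (j : ℝ) ≤ (k + 1) * (n + 1) := by
      rw [mul_comm]
      exact_mod_cast hjk
    calc _ ≤ c * j * B ^ l + c * (k + 1) * (n + 1) * B ^ l := by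
          refine (abs_sub _ _).trans ?_
          rw [abs_mul (c * j), abs_mul (c * (k + 1) * (n + 1)),
            abs_of_nonneg (by positivity : 0 ≤ c * j),
            abs_of_nonneg (by positivity : 0 ≤ c * (k + 1) * (n + 1))]
          gcongr
      _ ≤ c * ((k + 1) * (n + 1)) * B ^ l + c * (k + 1) * (n + 1) * B ^ l := by gcongr
      _ = B ^ l * (2 * c * (n + 1) * (k + 1)) := by ring
      _ ≤ B ^ l * B := by
          rw [hB]
          gcongr
          push_cast
          linarith [(Nat.cast_nonneg l : (0 : ℝ) ≤ l)]
      _ = B ^ (l + 1) := (pow_succ _ _).symm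

theorem tendsto_iteratedDerivWithin_powQuot_atTop (hc : 0 < c) (l : ℕ) {j k : ℕ}
    (hjk : j < (n + 1) * (k + 1)) :
    Tendsto (iteratedDerivWithin l (powQuot c n j k) (Ici 0)) atTop (𝓝 0) := by
  induction l generalizing j k with
  | zero => simpa using tendsto_powQuot_atTop hc hjk
  | succ l ih =>
    have h₁ := (ih (j := j - 1) (k := k) (by omega)).const_mul (c * j)
    have h₂ := (ih (j := j + n) (k := k + 1) (by nlinarith)).const_mul (c * (k + 1) * (n + 1))
    have h := h₁.sub h₂
    simp only [mul_zero, sub_zero] at h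
    refine h.congr' ?_
    filter_upwards [eventually_ge_atTop 0] with μ hμ
      using (iteratedDerivWithin_succ_powQuot hc l j k hμ).symm

end PowQuot

section SeriesOnIci

/-- A function differentiable on `[0, ∞)` extends affinely to a function differentiable on `ℝ`. -/
theorem hasDerivAt_affine_extension {f f' : ℝ → ℝ}
    (hf : ∀ x, 0 ≤ x → HasDerivWithinAt f (f' x) (Ici 0) x) (x : ℝ) :
    HasDerivAt (fun y => f (max y 0) + min y 0 * f' 0) (f' (max x 0)) x := by
  have hpos {y : ℝ} (hy : 0 ≤ y) : f (max y 0) + min y 0 * f' 0 = f y := by simp [hy]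
  have hneg {y : ℝ} (hy : y ≤ 0) : f (max y 0) + min y 0 * f' 0 = f 0 + y * f' 0 := by simp [hy]
  have haff : HasDerivAt (fun y => f 0 + y * f' 0) (f' 0) x := by
    simpa using ((hasDerivAt_id x).mul_const (f' 0)).const_add (f 0)
  rcases lt_trichotomy x 0 with hx | rfl | hx
  · rw [max_eq_right hx.le]
    refine haff.congr_of_eventuallyEq ?_
    filter_upwards [Iio_mem_nhds hx] with y hy using hneg (le_of_lt hy)
  · rw [max_self, ← hasDerivWithinAt_univ, ← Iic_union_Ici (a := (0 : ℝ))]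
    exact (haff.hasDerivWithinAt.congr (fun y hy => hneg hy) (hneg le_rfl)).union
      ((hf 0 le_rfl).congr (fun y hy => hpos hy) (hpos le_rfl))
  · rw [max_eq_left hx.le]
    refine ((hf x hx.le).hasDerivAt (Ici_mem_nhds hx)).congr_of_eventuallyEq ?_
    filter_upwards [Ioi_mem_nhds hx] with y hy using hpos (le_of_lt hy)

/-- Term-by-term differentiation of a series on the closed half-line `[0, ∞)`. -/
theorem hasDerivWithinAt_tsum_Ici {f f' : ℕ → ℝ → ℝ} {u : ℕ → ℝ} (hu : Summable u)
    (hf : ∀ n x, 0 ≤ x → HasDerivWithinAt (f n) (f' n x) (Ici 0) x)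
    (hf' : ∀ n x, 0 ≤ x → |f' n x| ≤ u n) (hf0 : Summable fun n => f n 0) {x : ℝ} (hx : 0 ≤ x) :
    HasDerivWithinAt (fun y => ∑' n, f n y) (∑' n, f' n x) (Ici 0) x := by
  have h := hasDerivAt_tsum (y₀ := 0) hu (fun n y => hasDerivAt_affine_extension (hf n) y)
    (fun n y => hf' n _ (le_max_right y 0)) (by simpa using hf0) x
  rw [max_eq_left hx] at h
  exact h.hasDerivWithinAt.congr (fun y (hy : 0 ≤ y) => by simp [hy]) (by simp [hx])

variable {f : ℕ → ℝ → ℝ} {u : ℕ → ℕ → ℝ}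

theorem hasDerivWithinAt_tsum_iteratedDerivWithin_Ici (hu : ∀ l, Summable (u l))
    (hf : ∀ n, ContDiffOn ℝ (⊤ : ℕ∞) (f n) (Ici 0))
    (hfu : ∀ l n x, 0 ≤ x → |iteratedDerivWithin l (f n) (Ici 0) x| ≤ u l n) (l : ℕ)
    {x : ℝ} (hx : 0 ≤ x) :
    HasDerivWithinAt (fun y => ∑' n, iteratedDerivWithin l (f n) (Ici 0) y)
      (∑' n, iteratedDerivWithin (l + 1) (f n) (Ici 0) x) (Ici 0) x := by
  refine hasDerivWithinAt_tsum_Ici (hu (l + 1)) (fun n y hy => ?_) (hfu (l + 1))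
    ((hu l).of_norm_bounded fun n => hfu l n 0 le_rfl) hx
  rw [iteratedDerivWithin_succ]
  exact ((hf n).differentiableOn_iteratedDerivWithin (mod_cast ENat.natCast_lt_top l)
    (uniqueDiffOn_Ici 0) y hy).hasDerivWithinAt

theorem iteratedDerivWithin_tsum_Ici (hu : ∀ l, Summable (u l))
    (hf : ∀ n, ContDiffOn ℝ (⊤ : ℕ∞) (f n) (Ici 0))
    (hfu : ∀ l n x, 0 ≤ x → |iteratedDerivWithin l (f n) (Ici 0) x| ≤ u l n) (l : ℕ) :
    EqOn (iteratedDerivWithin l (fun y => ∑' n, f n y) (Ici 0))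
      (fun x => ∑' n, iteratedDerivWithin l (f n) (Ici 0) x) (Ici 0) := by
  induction l with
  | zero => intro x _; simp
  | succ l ih =>
    intro x hx
    rw [iteratedDerivWithin_succ, derivWithin_congr ih (ih hx)]
    exact (hasDerivWithinAt_tsum_iteratedDerivWithin_Ici hu hf hfu l hx).derivWithin
      (uniqueDiffOn_Ici 0 x hx)

theorem contDiffOn_tsum_Ici (hu : ∀ l, Summable (u l))
    (hf : ∀ n, ContDiffOn ℝ (⊤ : ℕ∞) (f n) (Ici 0))
    (hfu : ∀ l n x, 0 ≤ x → |iteratedDerivWithin l (f n) (Ici 0) x| ≤ u l n) :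
    ContDiffOn ℝ (⊤ : ℕ∞) (fun y => ∑' n, f n y) (Ici 0) := by
  refine contDiffOn_of_differentiableOn_deriv fun l _ => ?_
  refine DifferentiableOn.congr (fun x hx => ?_) (iteratedDerivWithin_tsum_Ici hu hf hfu l)
  exact (hasDerivWithinAt_tsum_iteratedDerivWithin_Ici hu hf hfu l hx).differentiableWithinAt

theorem tendsto_iteratedDerivWithin_tsum_Ici (hu : ∀ l, Summable (u l))
    (hf : ∀ n, ContDiffOn ℝ (⊤ : ℕ∞) (f n) (Ici 0))
    (hfu : ∀ l n x, 0 ≤ x → |iteratedDerivWithin l (f n) (Ici 0) x| ≤ u l n) {l : ℕ}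
    (hlim : ∀ n, Tendsto (iteratedDerivWithin l (f n) (Ici 0)) atTop (𝓝 0)) :
    Tendsto (iteratedDerivWithin l (fun y => ∑' n, f n y) (Ici 0)) atTop (𝓝 0) := by
  have h := tendsto_tsum_of_dominated_convergence (hu l) hlim
    ((eventually_ge_atTop 0).mono fun x hx n => hfu l n x hx)
  rw [tsum_zero] at h
  refine h.congr' ?_
  filter_upwards [eventually_ge_atTop 0] with x hx
    using (iteratedDerivWithin_tsum_Ici hu hf hfu l hx).symm

end SeriesOnIci

theorem f2term_eq (a : ℕ → ℝ) (n : ℕ) :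
    f2term a n = fun μ => a (n + 1) * powQuot (n + 1) n n 0 μ := by
  ext μ
  simp [f2term, powQuot, mul_div_assoc]

theorem contDiffOn_f2term (a : ℕ → ℝ) (n : ℕ) :
    ContDiffOn ℝ (⊤ : ℕ∞) (f2term a n) (Ici 0) := by
  rw [f2term_eq]
  exact contDiffOn_const.mul (contDiffOn_powQuot (by positivity) n 0)

theorem abs_iteratedDerivWithin_f2term_le {ε : ℝ} {a : ℕ → ℝ}
    (ha : ∀ n : ℕ, 1 ≤ n → |a n| ≤ 4 * (3 / 4) ^ n * ε) (l n : ℕ) (μ : ℝ) (hμ : 0 ≤ μ) :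
    |iteratedDerivWithin l (f2term a n) (Ici 0) μ| ≤
      4 * ε * (2 * (l + 1)) ^ l * (((n + 1 : ℕ) : ℝ) ^ (2 * l) * (3 / 4) ^ (n + 1)) := by
  rw [f2term_eq, iteratedDerivWithin_const_mul_field, abs_mul]
  have hb := abs_iteratedDerivWithin_powQuot_le (c := (n : ℝ) + 1) (n := n) (by positivity) l
    (j := n) (k := 0) (by omega) hμ
  refine (mul_le_mul (ha (n + 1) (by omega)) hb (abs_nonneg _)
    ((abs_nonneg _).trans (ha (n + 1) (by omega)))).trans_eq ?_
  push_cast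
  rw [pow_mul, zero_add, show 2 * ((n : ℝ) + 1) * (n + 1) * (l + 1) =
    2 * (l + 1) * ((n : ℝ) + 1) ^ 2 by ring, mul_pow]
  ring

theorem tendsto_iteratedDerivWithin_f2term_atTop (a : ℕ → ℝ) (l n : ℕ) :
    Tendsto (iteratedDerivWithin l (f2term a n) (Ici 0)) atTop (𝓝 0) := by
  have h := (tendsto_iteratedDerivWithin_powQuot_atTop (c := (n : ℝ) + 1) (n := n)
    (by positivity) l (j := n) (k := 0) (by omega)).const_mul (a (n + 1))
  rw [mul_zero] at h
  refine h.congr fun μ => ?_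
  rw [f2term_eq, iteratedDerivWithin_const_mul_field]

/-- under the bound `|a_n| ≤ 4·(3/4)^n·ε`, the series `f₂` converges
absolutely and uniformly on `[0, ∞)` together with all its term-by-term derivatives,
defines a smooth function on `[0, ∞)`, and all its derivatives tend to `0` as
`μ → ∞`. -/
theorem stmt19 (ε : ℝ) (hε : 0 < ε) (a : ℕ → ℝ)
    (ha : ∀ n : ℕ, 1 ≤ n → |a n| ≤ 4 * (3 / 4) ^ n * ε) :
    (∀ l : ℕ,
      (∀ μ ∈ Set.Ici (0 : ℝ),
        Summable fun n => |iteratedDerivWithin l (f2term a n) (Set.Ici 0) μ|) ∧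
      TendstoUniformlyOn
        (fun N μ => ∑ n ∈ Finset.range N, iteratedDerivWithin l (f2term a n) (Set.Ici 0) μ)
        (fun μ => ∑' n, iteratedDerivWithin l (f2term a n) (Set.Ici 0) μ)
        Filter.atTop (Set.Ici 0)) ∧
    ContDiffOn ℝ (⊤ : ℕ∞) (f2series a) (Set.Ici 0) ∧
    (∀ l : ℕ,
      Filter.Tendsto (fun μ => iteratedDerivWithin l (f2series a) (Set.Ici 0) μ)
        Filter.atTop (nhds 0)) := by
  have hu (l : ℕ) : Summable fun n : ℕ =>
      4 * ε * (2 * (l + 1)) ^ l * (((n + 1 : ℕ) : ℝ) ^ (2 * l) * (3 / 4) ^ (n + 1)) :=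
    ((summable_nat_add_iff 1).2 (summable_pow_mul_geometric_of_norm_lt_one (2 * l)
      (r := (3 / 4 : ℝ)) (by norm_num))).mul_left _
  have hb := abs_iteratedDerivWithin_f2term_le ha
  refine ⟨fun l => ⟨fun μ hμ => (hu l).of_nonneg_of_le (fun _ => abs_nonneg _)
      fun n => hb l n μ hμ, tendstoUniformlyOn_tsum_nat (hu l) (hb l)⟩,
    contDiffOn_tsum_Ici hu (contDiffOn_f2term a) hb, fun l => ?_⟩
  exact tendsto_iteratedDerivWithin_tsum_Ici hu (contDiffOn_f2term a) hb
    fun n => tendsto_iteratedDerivWithin_f2term_atTop a l n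
end
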